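/- Let n ≥ 2 and let f ∈ ℂ[x₁,…,xₙ] be a non-constant polynomial with f(0) = 0 which is convenient and non-degenerate at 0, and such that V = {f = 0} has an isolated singular point at 0. With the deformation setup (P, l, σ_y f, V_y, Ω) fixed, let Ṽ := {(x,y) ∈ ℂⁿ × ℂ^l : σ_y f(x) = 0}. For every open subset U ⊆ Ω whose closure is compact and contained in Ω, there exists ε₀ > 0 such that for every ε with 0 < ε ≤ ε₀, the space Ṽ ∩ ((B(0,ε) ∖ {0}) × U) is homotopy equivalent to the space Ṽ ∩ (S(0,ε) × U), where B(0,ε) is the open ball of radius ε centered at 0 in ℂⁿ, S(0,ε) is the sphere of radius ε centered at 0 in ℂⁿ, and both spaces carry the subspace topology from ℂⁿ × ℂ^l. -/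

import Mathlib

open MvPolynomial

noncomputable section

/-- The exponent vector of a monomial, regarded as a point of `ℝⁿ`. -/
def expR {n : ℕ} (α : Fin n →₀ ℕ) : Fin n → ℝ := fun i => (α i : ℝ)

/-- The convex hull of the union, over `α ∈ s`, of the translates `α + ℝ₊ⁿ` of the
nonnegative orthant. -/
def newtonRegion {n : ℕ} (s : Set (Fin n →₀ ℕ)) : Set (Fin n → ℝ) :=
  convexHull ℝ {x | ∃ α ∈ s, ∃ r : Fin n → ℝ, (∀ i, 0 ≤ r i) ∧ x = expR α + r}

/-- The Newton polyhedron `Γ₊(f)` of `f` at the origin. -/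
def NewtonPolyhedron {n : ℕ} (f : MvPolynomial (Fin n) ℂ) : Set (Fin n → ℝ) :=
  newtonRegion {α | α ∈ f.support}

/-- The union of all bounded (nonempty, exposed) faces of `A`. -/
def boundedFacesUnion {n : ℕ} (A : Set (Fin n → ℝ)) : Set (Fin n → ℝ) :=
  {x | ∃ F : Set (Fin n → ℝ), F.Nonempty ∧ IsExposed ℝ A F ∧
    Bornology.IsBounded F ∧ x ∈ F}

/-- The Newton boundary `Γ_f` of `f`: the union of the bounded faces of `Γ₊(f)`. -/
def NewtonBoundary {n : ℕ} (f : MvPolynomial (Fin n) ℂ) : Set (Fin n → ℝ) :=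
  boundedFacesUnion (NewtonPolyhedron f)

/-- `f` is convenient: `Γ₊(f)` meets the positive part of every coordinate axis. -/
def Convenient {n : ℕ} (f : MvPolynomial (Fin n) ℂ) : Prop :=
  ∀ i : Fin n, ∃ t : ℝ, 0 < t ∧ Pi.single i t ∈ NewtonPolyhedron f

open Classical in
/-- The part `f_F` of `f` supported on a subset `F ⊆ ℝⁿ`. -/
def faceRestrict {n : ℕ} (f : MvPolynomial (Fin n) ℂ) (F : Set (Fin n → ℝ)) :
    MvPolynomial (Fin n) ℂ :=
  ∑ α ∈ f.support.filter (fun α => expR α ∈ F), monomial α (f.coeff α)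

/-- The system `g = ∂g/∂x₁ = ⋯ = ∂g/∂xₙ = 0` has a solution in `(ℂ ∖ {0})ⁿ`. -/
def hasTorusSolution {n : ℕ} (g : MvPolynomial (Fin n) ℂ) : Prop :=
  ∃ x : Fin n → ℂ, (∀ i, x i ≠ 0) ∧ eval x g = 0 ∧ ∀ i, eval x (pderiv i g) = 0

/-- `f` is non-degenerate at `0`: for every bounded face `F` of `Γ₊(f)` the system
`f_F = ∂f_F/∂x₁ = ⋯ = ∂f_F/∂xₙ = 0` has no solution in the torus. -/
def NondegAtZero {n : ℕ} (f : MvPolynomial (Fin n) ℂ) : Prop :=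
  ∀ F : Set (Fin n → ℝ), F.Nonempty → IsExposed ℝ (NewtonPolyhedron f) F →
    Bornology.IsBounded F → ¬ hasTorusSolution (faceRestrict f F)

/-- `x` is a singular point of the hypersurface `{h = 0} ⊆ ℂⁿ`. -/
def IsSingularPt {n : ℕ} (h : MvPolynomial (Fin n) ℂ) (x : Fin n → ℂ) : Prop :=
  eval x h = 0 ∧ ∀ i, eval x (pderiv i h) = 0

/-- The deformed polynomial `σ_y f = Σ_α (a_α + y_α) x^α`. -/
def perturb {n : ℕ} (f : MvPolynomial (Fin n) ℂ) (S : Finset (Fin n →₀ ℕ))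
    (y : {α // α ∈ S} → ℂ) : MvPolynomial (Fin n) ℂ :=
  f + ∑ α ∈ S.attach, monomial α.1 (y α)

/-- The parameter set `Ω ⊆ ℂ^{P ∩ ℤⁿ}`. -/
def Omega {n : ℕ} (f : MvPolynomial (Fin n) ℂ) (S : Finset (Fin n →₀ ℕ)) :
    Set ({α // α ∈ S} → ℂ) :=
  {y | NewtonBoundary (perturb f S y) = NewtonBoundary f ∧ NondegAtZero (perturb f S y)}

/-- The open Euclidean ball of radius `ε` centered at `0` in `ℂⁿ`. -/
def eBall (n : ℕ) (ε : ℝ) : Set (Fin n → ℂ) := {x | ∑ i, ‖x i‖ ^ 2 < ε ^ 2}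

/-- The Euclidean sphere of radius `ε` centered at `0` in `ℂⁿ`. -/
def eSphere (n : ℕ) (ε : ℝ) : Set (Fin n → ℂ) := {x | ∑ i, ‖x i‖ ^ 2 = ε ^ 2}

/-- The total deformed hypersurface `Ṽ = {(x,y) | σ_y f(x) = 0} ⊆ ℂⁿ × ℂ^l`. -/
def Vtilde {n : ℕ} (f : MvPolynomial (Fin n) ℂ) (S : Finset (Fin n →₀ ℕ)) :
    Set ((Fin n → ℂ) × ({α // α ∈ S} → ℂ)) :=
  {p | eval p.1 (perturb f S p.2) = 0}

section Flow

open Set Filter Topology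

/-- Along a trajectory of a cut-off vector field, the function `N` grows exponentially as long as
the trajectory is inside the region where the cut-off is trivial. -/
theorem eq_mul_exp_of_hasDerivAt_cutoff {Z Z' : Type*} {N : Z → ℝ}
    {G : Z → Z'} {B : Set Z'} {ψ : Z → ℝ}
    {a R : ℝ} (hN0 : ∀ z, 0 ≤ N z) (hψ : ∀ z, ψ z ∈ Icc (0 : ℝ) 1)
    (hψ1 : ∀ z, G z ∈ B → a ≤ N z → N z ≤ R → ψ z = 1) {γ : ℝ → Z}
    (hγN : ∀ t, HasDerivAt (fun t => N (γ t)) (ψ (γ t) * N (γ t)) t)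
    (hγG : ∀ t, G (γ t) = G (γ 0)) (hB : G (γ 0) ∈ B) (ha : a ≤ N (γ 0)) (hR : N (γ 0) ≤ R)
    {t : ℝ} (hat : a ≤ N (γ 0) * Real.exp t) (hRt : N (γ 0) * Real.exp t ≤ R) :
    N (γ t) = N (γ 0) * Real.exp t := by
  have hmono : Monotone fun t => N (γ t) :=
    monotone_of_hasDerivAt_nonneg hγN fun t => mul_nonneg (hψ _).1 (hN0 _)
  have hk : ∀ t, HasDerivAt (fun t => N (γ t) * Real.exp (-t))
      ((ψ (γ t) - 1) * (N (γ t) * Real.exp (-t))) t := by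
    intro t
    have := (hγN t).mul ((Real.hasDerivAt_exp (-t)).comp t (hasDerivAt_neg t))
    refine this.congr_deriv ?_
    simp only [Function.comp]
    ring
  have hanti : Antitone fun t => N (γ t) * Real.exp (-t) :=
    antitone_of_hasDerivAt_nonpos hk fun t =>
      mul_nonpos_of_nonpos_of_nonneg (by linarith [(hψ (γ t)).2])
        (mul_nonneg (hN0 _) (Real.exp_pos _).le)
  have hcont : Continuous fun t => N (γ t) * Real.exp (-t) :=
    continuous_iff_continuousAt.2 fun t => (hk t).continuousAt
  have hone : ∀ s, a ≤ N (γ s) → N (γ s) ≤ R → ψ (γ s) = 1 := fun s h1 h2 =>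
    hψ1 _ (by rw [hγG]; exact hB) h1 h2
  have hexp : ∀ s, N (γ s) = N (γ s) * Real.exp (-s) * Real.exp s := fun s => by
    rw [mul_assoc, ← Real.exp_add]; simp
  have key : N (γ t) * Real.exp (-t) = N (γ 0) := by
    rcases le_total 0 t with ht | ht
    · have hs : ∀ s ∈ Ico 0 t, ψ (γ s) = 1 := by
        intro s hs
        refine hone s (ha.trans (hmono hs.1)) (le_trans ?_ hRt)
        rw [hexp s]
        have h1 : N (γ s) * Real.exp (-s) ≤ N (γ 0) := by simpa using hanti hs.1
        have h2 : Real.exp s ≤ Real.exp t := Real.exp_le_exp.2 hs.2.le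
        have := hN0 (γ 0)
        gcongr
      have := constant_of_has_deriv_right_zero (f := fun t => N (γ t) * Real.exp (-t))
        (a := 0) (b := t) hcont.continuousOn
        (fun s hs' => by simpa [hs s hs'] using (hk s).hasDerivWithinAt (s := Ici s))
        t ⟨ht, le_rfl⟩
      simpa using this
    · have hs : ∀ s ∈ Icc t 0, ψ (γ s) = 1 := by
        intro s hs
        refine hone s (hat.trans ?_) ((hmono hs.2).trans hR)
        rw [hexp s]
        have h1 : N (γ 0) ≤ N (γ s) * Real.exp (-s) := by simpa using hanti hs.2
        have h2 : Real.exp t ≤ Real.exp s := Real.exp_le_exp.2 hs.1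
        have := mul_nonneg (hN0 (γ s)) (Real.exp_pos (-s)).le
        gcongr
      have := constant_of_has_deriv_right_zero (f := fun t => N (γ t) * Real.exp (-t))
        (a := t) (b := 0) hcont.continuousOn
        (fun s hs' => by
          simpa [hs s (Ico_subset_Icc_self hs')] using (hk s).hasDerivWithinAt (s := Ici s))
        0 ⟨ht, le_rfl⟩
      simpa using this.symm
  rw [hexp t, key]

variable {Z : Type*} [NormedAddCommGroup Z] [NormedSpace ℝ Z]

/-- A `C¹` vector field may be cut off outside a neighbourhood of a compact set so that it becomes
bounded and globally Lipschitz. -/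
theorem exists_cutoff_lipschitz_bounded [FiniteDimensional ℝ Z] {v : Z → Z} {W C : Set Z}
    (hW : IsOpen W) (hv : ContDiffOn ℝ 1 v W) (hC : IsCompact C) (hCW : C ⊆ W) :
    ∃ ψ : Z → ℝ, (∀ z, ψ z ∈ Icc (0 : ℝ) 1) ∧ (∀ z ∈ C, ψ z = 1) ∧ (∀ z ∉ W, ψ z = 0) ∧
      (∃ K, LipschitzWith K fun z => ψ z • v z) ∧
      ∃ L : NNReal, ∀ z, ‖ψ z • v z‖ ≤ L := by
  obtain ⟨T, hT, hCT, hTW⟩ := exists_compact_between hC hW hCW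
  obtain ⟨ψ, hψ1, hψ0, hψ⟩ := exists_contMDiffMap_one_nhds_of_subset_interior (n := 1)
    (modelWithCornersSelf ℝ Z) hC.isClosed hCT
  have hψd : ContDiff ℝ 1 ψ := ψ.contMDiff.contDiff
  have hw : ContDiff ℝ 1 fun z => ψ z • v z := by
    rw [contDiff_iff_contDiffAt]
    intro z
    by_cases hz : z ∈ W
    · exact hψd.contDiffAt.smul (hv.contDiffAt (hW.mem_nhds hz))
    · have : (fun z => ψ z • v z) =ᶠ[𝓝 z] fun _ => 0 := by
        filter_upwards [hT.isClosed.isOpen_compl.mem_nhds fun h => hz (hTW h)] with y hy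
        simp [hψ0 y hy]
      exact contDiffAt_const.congr_of_eventuallyEq this
  have hcs : HasCompactSupport fun z => ψ z • v z :=
    HasCompactSupport.intro hT fun z hz => by simp [hψ0 z hz]
  obtain ⟨L, hL⟩ := hcs.exists_bound_of_continuous hw.continuous
  refine ⟨ψ, hψ, fun z hz => hψ1.self_of_nhdsSet z hz, fun z hz => hψ0 z fun h => hz (hTW h),
    hw.lipschitzWith_of_hasCompactSupport hcs one_ne_zero, ⟨max L 0, le_max_right _ _⟩, fun z => ?_⟩
  exact (hL z).trans (le_max_left _ _)

theorem dist_le_of_hasDerivAt_of_lipschitz {w : Z → Z} {K : NNReal} (hw : LipschitzWith K w)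
    {γ δ : ℝ → Z} (hγ : ∀ t, HasDerivAt γ (w (γ t)) t) (hδ : ∀ t, HasDerivAt δ (w (δ t)) t)
    (t : ℝ) : dist (γ t) (δ t) ≤ dist (γ 0) (δ 0) * Real.exp (K * |t|) := by
  have key : ∀ {w : Z → Z}, LipschitzWith K w → ∀ {γ δ : ℝ → Z},
      (∀ t, HasDerivAt γ (w (γ t)) t) → (∀ t, HasDerivAt δ (w (δ t)) t) →
      ∀ t, 0 ≤ t → dist (γ t) (δ t) ≤ dist (γ 0) (δ 0) * Real.exp (K * t) := by
    intro w hw γ δ hγ hδ t ht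
    have := dist_le_of_trajectories_ODE (v := fun _ => w) (a := 0) (b := t) (fun _ => hw)
      (fun s _ => (hγ s).continuousAt.continuousWithinAt) (fun s _ => (hγ s).hasDerivWithinAt)
      (fun s _ => (hδ s).continuousAt.continuousWithinAt) (fun s _ => (hδ s).hasDerivWithinAt)
      le_rfl t ⟨ht, le_rfl⟩
    simpa using this
  rcases le_total 0 t with ht | ht
  · rw [abs_of_nonneg ht]; exact key hw hγ hδ t ht
  · have rev : ∀ {γ : ℝ → Z}, (∀ t, HasDerivAt γ (w (γ t)) t) →
        ∀ t, HasDerivAt (fun s => γ (-s)) ((fun z => -w z) ((fun s => γ (-s)) t)) t := by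
      intro γ hγ t
      simpa [Function.comp_def] using (hγ (-t)).scomp t (hasDerivAt_neg t)
    have := key hw.neg (rev hγ) (rev hδ) (-t) (by linarith)
    rw [abs_of_nonpos ht]
    simpa using this

/-- A bounded Lipschitz vector field has a global continuous flow. -/
theorem exists_global_flow [CompleteSpace Z] {w : Z → Z} {K L : NNReal} (hw : LipschitzWith K w)
    (hL : ∀ z, ‖w z‖ ≤ L) :
    ∃ φ : ℝ → Z → Z, (∀ z, φ 0 z = z) ∧ (∀ z t, HasDerivAt (φ · z) (w (φ t z)) t) ∧
      Continuous fun p : ℝ × Z => φ p.1 p.2 := by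
  have loc : ∀ (z : Z) (T : ℝ), ∃ α : ℝ → Z, 0 < T → α 0 = z ∧
      ∀ t ∈ Ioo (-T) T, HasDerivAt α (w (α t)) t := by
    intro z T
    by_cases hT : 0 < T
    swap
    · exact ⟨fun _ => z, fun h => absurd h hT⟩
    have h0 : (0 : ℝ) ∈ Icc (-T) T := ⟨by linarith, hT.le⟩
    have := IsPicardLindelof.of_time_independent (f := w) (t₀ := ⟨0, h0⟩) (x₀ := z)
      (a := L * ⟨T, hT.le⟩) (r := 0) (L := L) (K := K) (fun x _ => hL x) hw.lipschitzOnWith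
      (by simp only [sub_zero, zero_sub, neg_neg, max_self, NNReal.coe_zero]; exact le_of_eq rfl)
    obtain ⟨α, hα0, hα⟩ := this.exists_eq_forall_mem_Icc_hasDerivWithinAt₀
    exact ⟨α, fun _ => ⟨hα0, fun t ht =>
      (hα t (Ioo_subset_Icc_self ht)).hasDerivAt (Icc_mem_nhds ht.1 ht.2)⟩⟩
  choose α hα using loc
  have hcons : ∀ z T T', 0 < T → T ≤ T' → EqOn (α z T) (α z T') (Ioo (-T) T) := by
    intro z T T' hT hTT
    refine ODE_solution_unique_of_mem_Ioo (v := fun _ => w) (s := fun _ => univ) (t₀ := 0)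
      (fun _ _ => hw.lipschitzOnWith) ⟨by linarith, hT⟩
      (fun t ht => ⟨(hα z T hT).2 t ht, trivial⟩)
      (fun t ht => ⟨(hα z T' (hT.trans_le hTT)).2 t ⟨by linarith [ht.1], by linarith [ht.2]⟩,
        trivial⟩) ?_
    rw [(hα z T hT).1, (hα z T' (hT.trans_le hTT)).1]
  let φ : ℝ → Z → Z := fun t z => α z (|t| + 1) t
  have hφd : ∀ z t, HasDerivAt (φ · z) (w (φ t z)) t := by
    intro z t
    have hpos : 0 < |t| + 2 := by positivity
    have hev : (φ · z) =ᶠ[𝓝 t] α z (|t| + 2) := by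
      have : ∀ᶠ s in 𝓝 t, |s| < |t| + 1 :=
        continuous_abs.continuousAt.eventually_lt_const (by linarith)
      filter_upwards [this] with s hs
      refine hcons z (|s| + 1) (|t| + 2) (by positivity) (by linarith) ?_
      exact ⟨by linarith [neg_abs_le s], by linarith [le_abs_self s]⟩
    have hd := (hα z (|t| + 2) hpos).2 t
      ⟨by linarith [neg_abs_le t], by linarith [le_abs_self t]⟩
    rw [show φ t z = α z (|t| + 2) t from hev.self_of_nhds]
    exact hd.congr_of_eventuallyEq hev
  have hφ0 : ∀ z, φ 0 z = z := fun z => by simpa [φ] using (hα z (|0| + 1) (by simp)).1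
  refine ⟨φ, hφ0, hφd, ?_⟩
  rw [continuous_iff_continuousAt]
  rintro ⟨t, z⟩
  rw [ContinuousAt, tendsto_iff_dist_tendsto_zero]
  have h1 : Tendsto (fun p : ℝ × Z => dist p.2 z * Real.exp (K * |p.1|) + dist (φ p.1 z) (φ t z))
      (𝓝 (t, z)) (𝓝 0) := by
    have hc : Continuous (φ · z) := continuous_iff_continuousAt.2 fun s => (hφd z s).continuousAt
    have : Continuous fun p : ℝ × Z =>
        dist p.2 z * Real.exp (K * |p.1|) + dist (φ p.1 z) (φ t z) := by
      have := hc.comp (continuous_fst (X := ℝ) (Y := Z))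
      simp only [Function.comp_def] at this
      fun_prop
    simpa using this.tendsto (t, z)
  refine squeeze_zero (fun _ => dist_nonneg) (fun p => ?_) h1
  refine (dist_triangle _ (φ p.1 z) _).trans ?_
  have := dist_le_of_hasDerivAt_of_lipschitz hw (hφd p.2) (hφd z) p.1
  simp only [hφ0] at this
  gcongr

variable {Z' : Type*} [NormedAddCommGroup Z'] [NormedSpace ℝ Z']

/-- If a vector field `v` is tangent to the fibres of `G` and scales `N`, then flowing along `v`
moves points of `G ⁻¹' B` between levels of `N` below `R`. -/
theorem exists_levelFlow [FiniteDimensional ℝ Z] {v : Z → Z} {W : Set Z} (hW : IsOpen W)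
    (hv : ContDiffOn ℝ 1 v W) {N : Z → ℝ} {G : Z → Z'} (hN : Differentiable ℝ N)
    (hG : Differentiable ℝ G) (hN0 : ∀ z, 0 ≤ N z)
    (hNv : ∀ z ∈ W, fderiv ℝ N z (v z) = N z) (hGv : ∀ z ∈ W, fderiv ℝ G z (v z) = 0)
    {B : Set Z'} {R : ℝ} (hcpt : ∀ a > 0, IsCompact {z | G z ∈ B ∧ a ≤ N z ∧ N z ≤ R})
    (hsub : ∀ z, G z ∈ B → 0 < N z → N z ≤ R → z ∈ W) :
    ∃ Φ : ℝ → Z → Z,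
      (∀ t z, G z ∈ B → 0 < N z → N z ≤ R → N z * Real.exp t ≤ R →
        G (Φ t z) = G z ∧ N (Φ t z) = N z * Real.exp t) ∧
      (∀ z, Φ 0 z = z) ∧
      (∀ s t z, G z ∈ B → 0 < N z → N z ≤ R → N z * Real.exp s ≤ R →
        N z * Real.exp (s + t) ≤ R → Φ t (Φ s z) = Φ (s + t) z) ∧
      ContinuousOn (fun p : ℝ × Z => Φ p.1 p.2)
        {p | G p.2 ∈ B ∧ 0 < N p.2 ∧ N p.2 ≤ R ∧ N p.2 * Real.exp p.1 ≤ R} := by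
  have hex : ∀ a : ℝ, ∃ (ψ : Z → ℝ) (φ : ℝ → Z → Z), 0 < a →
      (∀ z, ψ z ∈ Icc (0 : ℝ) 1) ∧ (∀ z, G z ∈ B → a ≤ N z → N z ≤ R → ψ z = 1) ∧
      (∀ z ∉ W, ψ z = 0) ∧ (∃ K, LipschitzWith K fun z => ψ z • v z) ∧
      (∀ z, φ 0 z = z) ∧ (∀ z t, HasDerivAt (φ · z) (ψ (φ t z) • v (φ t z)) t) ∧
      Continuous fun p : ℝ × Z => φ p.1 p.2 := by
    intro a
    by_cases ha : 0 < a
    swap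
    · exact ⟨0, fun _ => id, fun h => absurd h ha⟩
    obtain ⟨ψ, h1, h2, h3, ⟨K, hK⟩, L, hL⟩ := exists_cutoff_lipschitz_bounded hW hv (hcpt a ha)
      fun z hz => hsub z hz.1 (ha.trans_le hz.2.1) hz.2.2
    obtain ⟨φ, h4, h5, h6⟩ := exists_global_flow hK hL
    exact ⟨ψ, φ, fun _ => ⟨h1, fun z hz ha hR => h2 z ⟨hz, ha, hR⟩, h3, ⟨K, hK⟩, h4, h5, h6⟩⟩
  choose ψ φ hφ using hex
  have hGφ : ∀ a > 0, ∀ z t, G (φ a t z) = G z := by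
    intro a ha z t
    obtain ⟨-, -, h0, -, h4, h5, -⟩ := hφ a ha
    have hd : ∀ t, HasDerivAt (fun t => G (φ a t z)) 0 t := by
      intro t
      have := (hG (φ a t z)).hasFDerivAt.comp_hasDerivAt t (h5 z t)
      refine this.congr_deriv ?_
      by_cases hz : φ a t z ∈ W
      · simp [hGv _ hz]
      · simp [h0 _ hz]
    have := is_const_of_deriv_eq_zero (fun t => (hd t).differentiableAt)
      (fun t => (hd t).deriv) t 0
    simpa [h4] using this
  have hNφ : ∀ a > 0, ∀ z t, G z ∈ B → a ≤ N z → N z ≤ R → a ≤ N z * Real.exp t →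
      N z * Real.exp t ≤ R → N (φ a t z) = N z * Real.exp t := by
    intro a ha z t hz h1 h2 h3 h4
    obtain ⟨hψ, hψ1, h0, -, hφ0, hφd, -⟩ := hφ a ha
    have := eq_mul_exp_of_hasDerivAt_cutoff (γ := (φ a · z)) (t := t) (a := a) (R := R)
      hN0 hψ hψ1 ?_ (fun t => by simp [hGφ a ha])
      (by simpa [hφ0]) (by simpa [hφ0]) (by simpa [hφ0]) (by simpa [hφ0]) (by simpa [hφ0])
    · simpa [hφ0] using this
    · intro t
      have := (hN (φ a t z)).hasFDerivAt.comp_hasDerivAt t (hφd z t)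
      refine this.congr_deriv ?_
      by_cases hz : φ a t z ∈ W
      · simp [hNv _ hz]
      · simp [h0 _ hz]
  have hcons : ∀ a b, 0 < b → b ≤ a → ∀ z t, G z ∈ B → a ≤ N z → N z ≤ R →
      a ≤ N z * Real.exp t → N z * Real.exp t ≤ R → φ a t z = φ b t z := by
    intro a b hb hba z t hz h1 h2 h3 h4
    have ha : 0 < a := hb.trans_le hba
    obtain ⟨-, hψ1, -, ⟨K, hK⟩, hφ0, hφd, -⟩ := hφ a ha
    obtain ⟨-, hψ1', -, -, hφ0', hφd', -⟩ := hφ b hb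
    have hmem : ∀ s ∈ uIcc 0 t, a ≤ N z * Real.exp s ∧ N z * Real.exp s ≤ R := by
      intro s hs
      have hNz := hN0 z
      rcases mem_uIcc.1 hs with hs | hs
      · exact ⟨h1.trans (le_mul_of_one_le_right hNz (Real.one_le_exp hs.1)),
          (mul_le_mul_of_nonneg_left (Real.exp_le_exp.2 hs.2) hNz).trans h4⟩
      · exact ⟨h3.trans (mul_le_mul_of_nonneg_left (Real.exp_le_exp.2 hs.1) hNz),
          (mul_le_of_le_one_right hNz (Real.exp_le_one_iff.2 hs.2)).trans h2⟩
    have hd' : ∀ s ∈ uIcc 0 t, HasDerivAt (φ b · z) (ψ a (φ b s z) • v (φ b s z)) s := by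
      intro s hs
      obtain ⟨h5, h6⟩ := hmem s hs
      have hNs := hNφ b hb z s hz (hba.trans h1) h2 (hba.trans h5) h6
      have hGs : G (φ b s z) ∈ B := by rw [hGφ b hb]; exact hz
      have := hφd' z s
      rwa [hψ1' _ hGs (by rw [hNs]; exact hba.trans h5) (by rw [hNs]; exact h6),
        ← hψ1 _ hGs (by rw [hNs]; exact h5) (by rw [hNs]; exact h6)] at this
    rcases le_total 0 t with ht | ht
    · rw [uIcc_of_le ht] at hd'
      exact ODE_solution_unique_of_mem_Icc_right (v := fun _ z => ψ a z • v z)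
        (s := fun _ => univ) (a := 0) (b := t) (fun _ _ => hK.lipschitzOnWith)
        (fun s _ => (hφd z s).continuousAt.continuousWithinAt)
        (fun s _ => (hφd z s).hasDerivWithinAt) (fun _ _ => trivial)
        (fun s hs => (hd' s hs).continuousAt.continuousWithinAt)
        (fun s hs => (hd' s (Ico_subset_Icc_self hs)).hasDerivWithinAt) (fun _ _ => trivial)
        (by simp [hφ0, hφ0']) ⟨ht, le_rfl⟩
    · rw [uIcc_of_ge ht] at hd'
      exact ODE_solution_unique_of_mem_Icc_left (v := fun _ z => ψ a z • v z)
        (s := fun _ => univ) (a := t) (b := 0) (fun _ _ => hK.lipschitzOnWith)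
        (fun s _ => (hφd z s).continuousAt.continuousWithinAt)
        (fun s _ => (hφd z s).hasDerivWithinAt) (fun _ _ => trivial)
        (fun s hs => (hd' s hs).continuousAt.continuousWithinAt)
        (fun s hs => (hd' s (Ioc_subset_Icc_self hs)).hasDerivWithinAt) (fun _ _ => trivial)
        (by simp [hφ0, hφ0']) ⟨le_rfl, ht⟩
  let Φ : ℝ → Z → Z := fun t z => if 0 < N z then φ (min (N z) (N z * Real.exp t)) t z else z
  have hΦ : ∀ b > 0, ∀ t z, G z ∈ B → b ≤ N z → N z ≤ R → b ≤ N z * Real.exp t →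
      N z * Real.exp t ≤ R → Φ t z = φ b t z := by
    intro b hb t z hz h1 h2 h3 h4
    have hpos : 0 < N z := hb.trans_le h1
    simp only [Φ, if_pos hpos]
    exact hcons _ b hb (le_min h1 h3) z t hz (min_le_left _ _) h2 (min_le_right _ _) h4
  have hNΦ : ∀ t z, G z ∈ B → 0 < N z → N z ≤ R → N z * Real.exp t ≤ R →
        G (Φ t z) = G z ∧ N (Φ t z) = N z * Real.exp t := by
    intro t z hz h1 h2 h3
    have hb : 0 < min (N z) (N z * Real.exp t) := lt_min h1 (by positivity)
    rw [hΦ _ hb t z hz (min_le_left _ _) h2 (min_le_right _ _) h3]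
    exact ⟨hGφ _ hb _ _, hNφ _ hb z t hz (min_le_left _ _) h2 (min_le_right _ _) h3⟩
  refine ⟨Φ, hNΦ, ?_, ?_, ?_⟩
  · intro z
    simp only [Φ]
    split_ifs with h
    · exact (hφ _ (lt_min h (by positivity))).2.2.2.2.1 z
    · rfl
  · intro s t z hz h1 h2 h3 h4
    set b := min (N z) (min (N z * Real.exp s) (N z * Real.exp (s + t))) with hbdef
    have hb : 0 < b := lt_min h1 (lt_min (by positivity) (by positivity))
    have hb1 : b ≤ N z := min_le_left _ _
    have hb2 : b ≤ N z * Real.exp s := (min_le_right _ _).trans (min_le_left _ _)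
    have hb3 : b ≤ N z * Real.exp (s + t) := (min_le_right _ _).trans (min_le_right _ _)
    obtain ⟨hG1, hN1⟩ := hNΦ s z hz h1 h2 h3
    have hN2 : N (Φ s z) * Real.exp t = N z * Real.exp (s + t) := by
      rw [hN1, Real.exp_add, mul_assoc]
    rw [hΦ b hb t (Φ s z) (by rwa [hG1]) (by rwa [hN1]) (by rwa [hN1]) (by rwa [hN2])
      (by rwa [hN2]), hΦ b hb s z hz hb1 h2 hb2 h3, hΦ b hb (s + t) z hz hb1 h2 hb3 h4]
    obtain ⟨-, -, -, ⟨K, hK⟩, hφ0, hφd, -⟩ := hφ b hb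
    have := ODE_solution_unique_univ (v := fun _ z => ψ b z • v z) (s := fun _ => univ) (t₀ := 0)
      (f := fun r => φ b r (φ b s z)) (g := fun r => φ b (s + r) z)
      (fun _ => hK.lipschitzOnWith) (fun r => ⟨hφd _ r, trivial⟩)
      (fun r => ⟨by
        have := (hφd z (s + r)).scomp r ((hasDerivAt_id r).const_add s)
        simpa [Function.comp_def] using this, trivial⟩)
      (by simp [hφ0])
    exact congrFun this t
  · rintro ⟨t, z⟩ ⟨hz, h1, h2, h3⟩
    simp only at hz h1 h2 h3
    set b := min (N z) (N z * Real.exp t) / 2 with hbdef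
    have hm : 0 < min (N z) (N z * Real.exp t) := lt_min h1 (by positivity)
    have hb : 0 < b := by positivity
    have hb1 : b < N z := (half_lt_self hm).trans_le (min_le_left _ _)
    have hb2 : b < N z * Real.exp t := (half_lt_self hm).trans_le (min_le_right _ _)
    have hNc : Continuous N := hN.continuous
    have e1 : ∀ᶠ p : ℝ × Z in 𝓝 (t, z), b < N p.2 :=
      (by fun_prop : Continuous fun p : ℝ × Z => N p.2).continuousAt.eventually_const_lt hb1
    have e2 : ∀ᶠ p : ℝ × Z in 𝓝 (t, z), b < N p.2 * Real.exp p.1 :=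
      (by fun_prop : Continuous fun p : ℝ × Z =>
        N p.2 * Real.exp p.1).continuousAt.eventually_const_lt hb2
    have hc := (hφ b hb).2.2.2.2.2.2
    refine hc.continuousAt.continuousWithinAt.congr_of_eventuallyEq ?_
      (hΦ b hb t z hz hb1.le h2 hb2.le h3)
    filter_upwards [nhdsWithin_le_nhds e1, nhdsWithin_le_nhds e2, self_mem_nhdsWithin]
      with p hp1 hp2 hp
    exact hΦ b hb p.1 p.2 hp.1 hp1.le hp.2.2.1 hp2.le hp.2.2.2

/-- In the situation of `exists_levelFlow`, a punctured sublevel set of `N` is homotopy equivalent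
to the corresponding level set. -/
theorem nonempty_homotopyEquiv_of_levelFlow [FiniteDimensional ℝ Z] {v : Z → Z} {W : Set Z}
    (hW : IsOpen W)
    (hv : ContDiffOn ℝ 1 v W) {N : Z → ℝ} {G : Z → Z'} (hN : Differentiable ℝ N)
    (hG : Differentiable ℝ G) (hN0 : ∀ z, 0 ≤ N z)
    (hNv : ∀ z ∈ W, fderiv ℝ N z (v z) = N z) (hGv : ∀ z ∈ W, fderiv ℝ G z (v z) = 0)
    {B : Set Z'} {R : ℝ} (hR : 0 < R)
    (hcpt : ∀ a > 0, IsCompact {z | G z ∈ B ∧ a ≤ N z ∧ N z ≤ R})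
    (hsub : ∀ z, G z ∈ B → 0 < N z → N z ≤ R → z ∈ W) {O : Set Z'} (hO : O ⊆ B) :
    Nonempty (ContinuousMap.HomotopyEquiv
      ↥{z | G z ∈ O ∧ 0 < N z ∧ N z < R} ↥{z | G z ∈ O ∧ N z = R}) := by
  obtain ⟨Φ, hΦ, hΦ0, hadd, hcont⟩ :=
    exists_levelFlow hW hv hN hG hN0 hNv hGv hcpt hsub
  have hNc : Continuous N := hN.continuous
  have hexp : ∀ {x : ℝ}, 0 < x → x * Real.exp (Real.log (R / x)) = R := fun {x} hx => by
    rw [Real.exp_log (by positivity)]; field_simp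
  have hexp1 : R * Real.exp (-1) < R :=
    mul_lt_of_lt_one_right hR (by simp)
  let r : C({z | G z ∈ O ∧ 0 < N z ∧ N z < R}, {z | G z ∈ O ∧ N z = R}) :=
    { toFun := fun z => ⟨Φ (Real.log (R / N z)) z, by
        obtain ⟨z, hz, h1, h2⟩ := z
        obtain ⟨h3, h4⟩ := hΦ (Real.log (R / N z)) z (hO hz) h1 h2.le (hexp h1).le
        exact ⟨by rwa [h3], by rw [h4, hexp h1]⟩⟩
      continuous_toFun := by
        refine Continuous.subtype_mk (hcont.comp_continuous
          (f := fun z : {z | G z ∈ O ∧ 0 < N z ∧ N z < R} =>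
            ((Real.log (R / N z), (z : Z)) : ℝ × Z)) ?_ ?_) _
        · refine Continuous.prodMk (Continuous.log ?_ ?_) continuous_subtype_val
          · exact continuous_const.div (by fun_prop) fun z => z.2.2.1.ne'
          · exact fun z => (div_pos hR z.2.2.1).ne'
        · exact fun z => ⟨hO z.2.1, z.2.2.1, z.2.2.2.le, (hexp z.2.2.1).le⟩ }
  let s : C({z | G z ∈ O ∧ N z = R}, {z | G z ∈ O ∧ 0 < N z ∧ N z < R}) :=
    { toFun := fun z => ⟨Φ (-1) z, by
        obtain ⟨z, hz, h1⟩ := z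
        obtain ⟨h3, h4⟩ := hΦ (-1) z (hO hz) (h1 ▸ hR) h1.le (by rw [h1]; exact hexp1.le)
        refine ⟨by rwa [h3], ?_⟩
        rw [h4, h1]
        exact ⟨by positivity, hexp1⟩⟩
      continuous_toFun := by
        refine Continuous.subtype_mk (hcont.comp_continuous
          (f := fun z : {z | G z ∈ O ∧ N z = R} => ((-1, (z : Z)) : ℝ × Z)) (by fun_prop) ?_) _
        intro z
        have := z.2.2
        exact ⟨hO z.2.1, hR.trans_eq this.symm, this.le, by simp only [this]; exact hexp1.le⟩ }
  have hbd : ∀ (τ : unitInterval) (x : ℝ), 0 < x → x < R →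
      x * Real.exp (τ * (Real.log (R / x) - 1)) < R := by
    intro τ x hx hxR
    have h0 : 0 < Real.log (R / x) := Real.log_pos ((one_lt_div hx).2 hxR)
    conv_rhs => rw [← hexp hx]
    have : (τ : ℝ) * (Real.log (R / x) - 1) < Real.log (R / x) := by
      have h1 := τ.2.1
      have h2 := τ.2.2
      rcases h1.eq_or_lt with h | h
      · rw [← h]; simpa using h0
      · nlinarith
    gcongr
  refine ⟨⟨r, s, ?_, ?_⟩⟩
  · refine ContinuousMap.Homotopic.symm ⟨⟨⟨fun p =>
      ⟨Φ (p.1 * (Real.log (R / N p.2) - 1)) p.2, ?_⟩, ?_⟩, ?_, ?_⟩⟩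
    · obtain ⟨τ, z, hz, h1, h2⟩ := p
      have h5 := hbd τ (N z) h1 h2
      obtain ⟨h3, h4⟩ := hΦ (τ * (Real.log (R / N z) - 1)) z (hO hz) h1 h2.le h5.le
      refine ⟨by simpa [h3] using hz, ?_⟩
      simp only
      rw [h4]
      exact ⟨by positivity, h5⟩
    · refine Continuous.subtype_mk (hcont.comp_continuous
          (f := fun p : unitInterval × {z | G z ∈ O ∧ 0 < N z ∧ N z < R} =>
            ((p.1 * (Real.log (R / N p.2) - 1), (p.2 : Z)) : ℝ × Z)) ?_ ?_) _
      · refine Continuous.prodMk (Continuous.mul (by fun_prop)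
          (Continuous.sub (Continuous.log ?_ ?_) continuous_const)) (by fun_prop)
        · exact continuous_const.div (by fun_prop) fun p => p.2.2.2.1.ne'
        · exact fun p => (div_pos hR p.2.2.2.1).ne'
      · exact fun p => ⟨hO p.2.2.1, p.2.2.2.1, p.2.2.2.2.le,
          (hbd p.1 _ p.2.2.2.1 p.2.2.2.2).le⟩
    · intro z
      ext1
      simp [hΦ0]
    · rintro ⟨z, hz, h1, h2⟩
      ext1
      have h5 := hbd 1 (N z) h1 h2
      have := hadd (Real.log (R / N z)) (-1) z (hO hz) h1 h2.le (hexp h1).le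
        (by simpa [sub_eq_add_neg] using h5.le)
      simpa [r, s, sub_eq_add_neg] using this.symm
  · have : r.comp s = ContinuousMap.id _ := by
      ext1 ⟨z, hz, h1⟩
      ext1
      obtain ⟨h3, h4⟩ := hΦ (-1) z (hO hz) (h1 ▸ hR) h1.le (by rw [h1]; exact hexp1.le)
      have hl : Real.log (R / N (Φ (-1) z)) = 1 := by
        rw [h4, h1, div_mul_cancel_left₀ hR.ne', ← Real.exp_neg, Real.log_exp, neg_neg]
      have := hadd (-1) 1 z (hO hz) (h1 ▸ hR) h1.le (by rw [h1]; exact hexp1.le)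
        (by simp [h1])
      simp only [r, s, ContinuousMap.comp_apply, ContinuousMap.coe_mk, ContinuousMap.id_apply]
      rw [hl, this]
      simp [hΦ0]
    rw [this]

end Flow

section NewtonGeometry

open Set

variable {n : ℕ}

theorem expR_mem_newtonPolyhedron {p : MvPolynomial (Fin n) ℂ} {α : Fin n →₀ ℕ}
    (hα : α ∈ p.support) : expR α ∈ NewtonPolyhedron p :=
  subset_convexHull ℝ _ ⟨α, hα, 0, fun _ => le_rfl, by simp⟩

theorem nonneg_of_mem_newtonPolyhedron {p : MvPolynomial (Fin n) ℂ} {z : Fin n → ℝ}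
    (hz : z ∈ NewtonPolyhedron p) : 0 ≤ z := by
  refine convexHull_min (t := Ici 0) ?_ (convex_Ici 0) hz
  rintro _ ⟨α, -, r, hr, rfl⟩ i
  exact add_nonneg (Nat.cast_nonneg (α i)) (hr i)

theorem le_dotProduct_of_mem_newtonPolyhedron {p : MvPolynomial (Fin n) ℂ} {w : Fin n → ℝ}
    (hw : ∀ i, 0 ≤ w i) {m : ℝ} (hm : ∀ α ∈ p.support, m ≤ w ⬝ᵥ expR α) {z : Fin n → ℝ}
    (hz : z ∈ NewtonPolyhedron p) : m ≤ w ⬝ᵥ z := by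
  refine convexHull_min (t := {z | m ≤ w ⬝ᵥ z}) ?_ ?_ hz
  · rintro _ ⟨α, hα, r, hr, rfl⟩
    change m ≤ w ⬝ᵥ (expR α + r)
    rw [dotProduct_add]
    exact le_add_of_le_of_nonneg (hm α hα) (Finset.sum_nonneg fun i _ => mul_nonneg (hw i) (hr i))
  · refine convex_halfSpace_ge ⟨fun x y => dotProduct_add w x y, fun c x => ?_⟩ m
    exact dotProduct_smul c w x

theorem support_nonempty_of_mem_newtonPolyhedron {p : MvPolynomial (Fin n) ℂ} {z : Fin n → ℝ}
    (hz : z ∈ NewtonPolyhedron p) : p.support.Nonempty := by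
  obtain ⟨_, α, hα, -⟩ := convexHull_nonempty_iff.1 ⟨z, hz⟩
  exact ⟨α, hα⟩

/-- A convenient polynomial contains a pure power of each variable. -/
theorem Convenient.exists_mem_support {p : MvPolynomial (Fin n) ℂ} (hp : Convenient p)
    (i : Fin n) : ∃ α ∈ p.support, ∀ j ≠ i, α j = 0 := by
  obtain ⟨t, -, ht⟩ := hp i
  by_contra! h
  have := le_dotProduct_of_mem_newtonPolyhedron (w := fun j => if j = i then 0 else 1) (m := 1)
    (fun j => by positivity) (fun α hα => ?_) ht
  · norm_num [dotProduct, Finset.sum_ite] at this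
  · obtain ⟨j, hj, hj0⟩ := h α hα
    have h1 : (1 : ℝ) ≤ α j := by exact_mod_cast Nat.one_le_iff_ne_zero.2 hj0
    refine h1.trans ?_
    have := Finset.single_le_sum (f := fun k => (if k = i then (0 : ℝ) else 1) * expR α k)
      (fun k _ => mul_nonneg (by positivity) (Nat.cast_nonneg _)) (Finset.mem_univ j)
    simpa [hj, expR, dotProduct] using this

/-- The face of the Newton polyhedron on which the weight `w` is minimal. -/
def minFace (p : MvPolynomial (Fin n) ℂ) (w : Fin n → ℝ) : Set (Fin n → ℝ) :=
  {z ∈ NewtonPolyhedron p | ∀ z' ∈ NewtonPolyhedron p, w ⬝ᵥ z ≤ w ⬝ᵥ z'}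

theorem isExposed_minFace (p : MvPolynomial (Fin n) ℂ) (w : Fin n → ℝ) :
    IsExposed ℝ (NewtonPolyhedron p) (minFace p w) := fun _ =>
  ⟨-∑ i, w i • ContinuousLinearMap.proj i, by
    simp [minFace, dotProduct]⟩

theorem isBounded_minFace (p : MvPolynomial (Fin n) ℂ) {w : Fin n → ℝ} (hw : ∀ i, 0 < w i) :
    Bornology.IsBounded (minFace p w) := by
  rcases (minFace p w).eq_empty_or_nonempty with h | ⟨z₀, hz₀⟩
  · simp [h]
  refine (Metric.isBounded_Icc (0 : Fin n → ℝ) fun i => w ⬝ᵥ z₀ / w i).subset fun z hz => ?_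
  have h0 := nonneg_of_mem_newtonPolyhedron hz.1
  refine ⟨h0, fun i => (le_div_iff₀' (hw i)).2 ?_⟩
  refine le_trans ?_ (hz.2 z₀ hz₀.1)
  exact Finset.single_le_sum (f := fun i => w i * z i)
    (fun i _ => mul_nonneg (hw i).le (h0 i)) (Finset.mem_univ i)

theorem exists_mem_support_mem_minFace {p : MvPolynomial (Fin n) ℂ} (hp : p.support.Nonempty)
    {w : Fin n → ℝ} (hw : ∀ i, 0 ≤ w i) : ∃ α ∈ p.support, expR α ∈ minFace p w := by
  obtain ⟨α, hα, hmin⟩ := p.support.exists_min_image (fun α => w ⬝ᵥ expR α) hp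
  exact ⟨α, hα, expR_mem_newtonPolyhedron hα, fun z hz =>
    le_dotProduct_of_mem_newtonPolyhedron hw hmin hz⟩

/-- If `f` and `g` have the same Newton boundary and `A` is a set of exponents in the Newton
polyhedron of `f` containing the supports of both, then for every positive weight the exponents of
`g` on the minimal face of `g` are exactly those of minimal weight in `A`. -/
theorem expR_mem_minFace_iff {f g : MvPolynomial (Fin n) ℂ}
    (hfg : NewtonBoundary g = NewtonBoundary f) {A : Finset (Fin n →₀ ℕ)} (hgA : g.support ⊆ A)
    (hA : ∀ α ∈ A, expR α ∈ NewtonPolyhedron f) {w : Fin n → ℝ}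
    (hw : ∀ i, 0 < w i) {α₀ : Fin n →₀ ℕ} (hα₀ : α₀ ∈ A)
    (hmin : ∀ α ∈ A, w ⬝ᵥ expR α₀ ≤ w ⬝ᵥ expR α) :
    (minFace g w).Nonempty ∧
      ∀ α ∈ g.support, expR α ∈ minFace g w ↔ w ⬝ᵥ expR α = w ⬝ᵥ expR α₀ := by
  obtain ⟨α₁, hα₁, hf⟩ := exists_mem_support_mem_minFace
    (support_nonempty_of_mem_newtonPolyhedron (hA α₀ hα₀)) fun i => (hw i).le
  have hg : expR α₁ ∈ NewtonPolyhedron g := by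
    have : expR α₁ ∈ NewtonBoundary g :=
      hfg ▸ ⟨_, ⟨_, hf⟩, isExposed_minFace f w, isBounded_minFace f hw, hf⟩
    obtain ⟨F, -, hF, -, h⟩ := this
    exact hF.subset h
  obtain ⟨β, hβ, hβF⟩ := exists_mem_support_mem_minFace
    (support_nonempty_of_mem_newtonPolyhedron hg) fun i => (hw i).le
  have h : w ⬝ᵥ expR β = w ⬝ᵥ expR α₀ :=
    ((hβF.2 _ hg).trans (hf.2 _ (hA α₀ hα₀))).antisymm (hmin β (hgA hβ))
  refine ⟨⟨_, hβF⟩, fun α hα => ⟨fun hαF => ?_, fun hαα => ?_⟩⟩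
  · rw [← h]
    exact (hαF.2 _ hβF.1).antisymm (hβF.2 _ hαF.1)
  · exact ⟨expR_mem_newtonPolyhedron hα, fun z hz => (hαα.trans h.symm).le.trans (hβF.2 z hz)⟩

theorem eval_monomial_eq_mul_prod (x : Fin n → ℂ) (α : Fin n →₀ ℕ) (c : ℂ) :
    eval x (monomial α c) = c * ∏ i, x i ^ α i := by
  rw [eval_monomial, Finsupp.prod_fintype _ _ fun i => pow_zero _]

theorem mul_eval_pderiv_monomial (x : Fin n → ℂ) (α : Fin n →₀ ℕ) (c : ℂ) (i : Fin n) :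
    x i * eval x (pderiv i (monomial α c)) = α i * (c * ∏ i, x i ^ α i) := by
  have := congrArg (eval x) (X_mul_pderiv_monomial (i := i) (m := α) (r := c))
  simpa [eval_monomial_eq_mul_prod] using this

/-- Non-degeneracy of `g` in terms of the exponents of minimal weight in `A`. -/
theorem NondegAtZero.not_torus_solution {f g : MvPolynomial (Fin n) ℂ} (hg : NondegAtZero g)
    (hfg : NewtonBoundary g = NewtonBoundary f) {A : Finset (Fin n →₀ ℕ)} (hgA : g.support ⊆ A)
    (hA : ∀ α ∈ A, expR α ∈ NewtonPolyhedron f) {w : Fin n → ℝ}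
    (hw : ∀ i, 0 < w i) {α₀ : Fin n →₀ ℕ} (hα₀ : α₀ ∈ A)
    (hmin : ∀ α ∈ A, w ⬝ᵥ expR α₀ ≤ w ⬝ᵥ expR α) {D : Finset (Fin n →₀ ℕ)}
    (hD : ∀ α, α ∈ D ↔ α ∈ A ∧ w ⬝ᵥ expR α = w ⬝ᵥ expR α₀) {u : Fin n → ℂ} (hu : ∀ i, u i ≠ 0)
    (h0 : ∑ α ∈ D, g.coeff α * ∏ i, u i ^ α i = 0)
    (h1 : ∀ i, ∑ α ∈ D, (α i : ℂ) * (g.coeff α * ∏ i, u i ^ α i) = 0) : False := by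
  classical
  obtain ⟨hne, hF⟩ := expR_mem_minFace_iff hfg hgA hA hw hα₀ hmin
  have key : faceRestrict g (minFace g w) = ∑ α ∈ D, monomial α (g.coeff α) := by
    rw [faceRestrict]
    refine (Finset.sum_congr (by congr) fun _ _ => rfl).trans
      (Finset.sum_subset (s₁ := g.support.filter fun α => expR α ∈ minFace g w)
        (fun α hα => ?_) fun α hα hα' => ?_)
    · obtain ⟨h1, h2⟩ := Finset.mem_filter.1 hα
      exact (hD α).2 ⟨hgA h1, (hF α h1).1 h2⟩
    · have : α ∉ g.support := fun h =>
        hα' (Finset.mem_filter.2 ⟨h, (hF α h).2 ((hD α).1 hα).2⟩)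
      rw [notMem_support_iff.1 this, monomial_zero]
  refine hg _ hne (isExposed_minFace g w) (isBounded_minFace g hw) ⟨u, hu, ?_, fun i => ?_⟩
  · simpa only [key, map_sum, eval_monomial_eq_mul_prod] using h0
  · refine (mul_eq_zero_iff_left (hu i)).1 ?_
    simpa only [key, map_sum, Finset.mul_sum, mul_eval_pderiv_monomial] using h1 i

end NewtonGeometry

section TorusEstimate

open Set Filter Topology

variable {n : ℕ}

theorem exists_linearMap_comp_comp_eq {V V' : Type*} [AddCommGroup V] [Module ℝ V]
    [AddCommGroup V'] [Module ℝ V'] (L : V →ₗ[ℝ] V') :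
    ∃ T : V' →ₗ[ℝ] V, ∀ v, L (T (L v)) = L v := by
  obtain ⟨s, hs⟩ := L.rangeRestrict.exists_rightInverse_of_surjective L.range_rangeRestrict
  obtain ⟨T, hT⟩ := s.exists_extend
  refine ⟨T, fun v => ?_⟩
  have h1 : T (L v) = s (L.rangeRestrict v) := LinearMap.congr_fun hT (L.rangeRestrict v)
  have h2 := LinearMap.congr_fun hs (L.rangeRestrict v)
  rw [h1]
  exact congrArg Subtype.val h2

theorem exists_tendsto_of_eventually_mem {ι E : Type*} [TopologicalSpace E] (𝓤 : Ultrafilter ι)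
    {K : Set E} (hK : IsCompact K) {v : ι → E} (hv : ∀ᶠ k in (𝓤 : Filter ι), v k ∈ K) :
    ∃ a ∈ K, Tendsto v 𝓤 (𝓝 a) :=
  hK.ultrafilter_le_nhds (𝓤.map v) (le_principal_iff.2 hv)

/-- Weights going to infinity along an ultrafilter can be moved by a convergent correction so that
the exponents in `A` of bounded excess weight get exactly the minimal weight. -/
theorem exists_weight_correction {ι : Type*} (𝓤 : Ultrafilter ι) {A : Finset (Fin n →₀ ℕ)}
    (hA : A.Nonempty) {w : ι → Fin n → ℝ} (hw : ∀ i, Tendsto (fun k => w k i) 𝓤 atTop) :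
    ∃ α₀ ∈ A, ∃ D ⊆ A, ∃ b : ι → Fin n → ℝ, (∃ c, Tendsto b 𝓤 (𝓝 c)) ∧
      (∀ᶠ k in (𝓤 : Filter ι), ∀ i, 0 < (w k - b k) i) ∧
      (∀ k, ∀ α ∈ D, (w k - b k) ⬝ᵥ expR α = (w k - b k) ⬝ᵥ expR α₀) ∧
      ∀ α ∈ A, α ∉ D →
        Tendsto (fun k => (w k - b k) ⬝ᵥ expR α - (w k - b k) ⬝ᵥ expR α₀) 𝓤 atTop := by
  classical
  have : ∀ᶠ k in (𝓤 : Filter ι), ∃ α₀ ∈ (A : Set (Fin n →₀ ℕ)),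
      ∀ α ∈ A, w k ⬝ᵥ expR α₀ ≤ w k ⬝ᵥ expR α :=
    Eventually.of_forall fun k => A.exists_min_image (fun α => w k ⬝ᵥ expR α) hA
  obtain ⟨α₀, hα₀, hmin⟩ := (Ultrafilter.eventually_exists_mem_iff A.finite_toSet).1 this
  let D := A.filter fun α => ∃ C, ∀ᶠ k in (𝓤 : Filter ι), w k ⬝ᵥ (expR α - expR α₀) ≤ C
  let L : (Fin n → ℝ) →ₗ[ℝ] (D → ℝ) :=
    { toFun := fun v α => v ⬝ᵥ (expR α.1 - expR α₀)
      map_add' := fun v v' => funext fun α => add_dotProduct v v' _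
      map_smul' := fun c v => funext fun α => smul_dotProduct c v _ }
  obtain ⟨T, hT⟩ := exists_linearMap_comp_comp_eq L
  have hD : ∀ α : D, ∃ C, ∀ᶠ k in (𝓤 : Filter ι), w k ⬝ᵥ (expR α.1 - expR α₀) ≤ C :=
    fun α => (Finset.mem_filter.1 α.2).2
  choose C hC using hD
  obtain ⟨a, -, ha⟩ := exists_tendsto_of_eventually_mem 𝓤 (isCompact_Icc (a := 0) (b := C))
    (v := fun k => L (w k)) (by
      filter_upwards [hmin, eventually_all.2 hC] with k h1 h2
      refine ⟨fun α => ?_, h2⟩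
      change 0 ≤ w k ⬝ᵥ (expR α.1 - expR α₀)
      rw [dotProduct_sub, sub_nonneg]
      exact h1 _ (Finset.mem_filter.1 α.2).1)
  have hb : Tendsto (fun k => T (L (w k))) 𝓤 (𝓝 (T a)) :=
    (T.continuous_of_finiteDimensional.tendsto a).comp ha
  have hbi := tendsto_pi_nhds.1 hb
  refine ⟨α₀, hα₀, D, Finset.filter_subset _ _, fun k => T (L (w k)), ⟨_, hb⟩, ?_, ?_, ?_⟩
  · refine eventually_all.2 fun i => ?_
    exact ((hw i).atTop_add (hbi i).neg).eventually_gt_atTop 0 |>.mono fun k hk => by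
      simpa [sub_eq_add_neg] using hk
  · intro k α hα
    rw [← sub_eq_zero, ← dotProduct_sub]
    have : L (w k - T (L (w k))) = 0 := by rw [map_sub, hT, sub_self]
    exact congrFun this ⟨α, hα⟩
  · intro α hα hαD
    have h1 : Tendsto (fun k => w k ⬝ᵥ (expR α - expR α₀)) 𝓤 atTop := by
      refine tendsto_atTop.2 fun C => ?_
      have : ¬ ∀ᶠ k in (𝓤 : Filter ι), w k ⬝ᵥ (expR α - expR α₀) ≤ C := fun h =>
        hαD (Finset.mem_filter.2 ⟨hα, C, h⟩)
      exact (Ultrafilter.eventually_not.2 this).mono fun k hk => (not_le.1 hk).le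
    have h2 : Tendsto (fun k => T (L (w k)) ⬝ᵥ (expR α - expR α₀)) 𝓤
        (𝓝 (T a ⬝ᵥ (expR α - expR α₀))) :=
      ((continuous_id.dotProduct continuous_const).tendsto (T a)).comp hb
    refine (h1.atTop_add h2.neg).congr fun k => ?_
    simp only [dotProduct_sub, sub_dotProduct]
    ring

theorem prod_pow_eq_exp_mul {x u : Fin n → ℂ} {w : Fin n → ℝ}
    (h : ∀ i, x i = (Real.exp (-w i) : ℝ) * u i) (α : Fin n →₀ ℕ) :
    ∏ i, x i ^ α i = (Real.exp (-(w ⬝ᵥ expR α)) : ℝ) * ∏ i, u i ^ α i := by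
  have : (Real.exp (-(w ⬝ᵥ expR α)) : ℝ) = ∏ i, Real.exp (-w i) ^ α i := by
    rw [dotProduct, ← Finset.sum_neg_distrib, Real.exp_sum]
    refine Finset.prod_congr rfl fun i _ => ?_
    rw [← Real.exp_nat_mul, expR]
    ring_nf
  rw [this, Complex.ofReal_prod, ← Finset.prod_mul_distrib]
  refine Finset.prod_congr rfl fun i _ => ?_
  rw [h i, mul_pow, Complex.ofReal_pow]

/-- Along an ultrafilter, a point of the torus tending to `0` has a leading part: after rescaling
by weights, sums of monomials over `A` converge to the sum over the exponents of minimal weight. -/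
theorem exists_leading_part {ι : Type*} (𝓤 : Ultrafilter ι) {A : Finset (Fin n →₀ ℕ)}
    (hA : A.Nonempty) {x : ι → Fin n → ℂ} (hx : Tendsto x 𝓤 (𝓝 0)) (hx0 : ∀ k i, x k i ≠ 0) :
    ∃ w : Fin n → ℝ, (∀ i, 0 < w i) ∧ ∃ α₀ ∈ A, (∀ α ∈ A, w ⬝ᵥ expR α₀ ≤ w ⬝ᵥ expR α) ∧
      ∃ D : Finset (Fin n →₀ ℕ), (∀ α, α ∈ D ↔ α ∈ A ∧ w ⬝ᵥ expR α = w ⬝ᵥ expR α₀) ∧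
      ∃ u : Fin n → ℂ, (∀ i, u i ≠ 0) ∧ ∃ N : ι → ℝ, (∀ k, 0 < N k) ∧
        (∀ α ∈ A, Tendsto (fun k => ‖∏ i, x k i ^ α i‖ / N k) 𝓤
          (𝓝 (if α ∈ D then ‖∏ i, u i ^ α i‖ else 0))) ∧
        ∀ (c : ι → (Fin n →₀ ℕ) → ℂ) (c₀ : (Fin n →₀ ℕ) → ℂ),
          (∀ α ∈ A, Tendsto (fun k => c k α) 𝓤 (𝓝 (c₀ α))) →
          Tendsto (fun k => (∑ α ∈ A, c k α * ∏ i, x k i ^ α i) / N k) 𝓤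
            (𝓝 (∑ α ∈ D, c₀ α * ∏ i, u i ^ α i)) := by
  classical
  have hxi := tendsto_pi_nhds.1 hx
  have hw : ∀ i, Tendsto (fun k => -Real.log ‖x k i‖) 𝓤 atTop := fun i => by
    refine tendsto_neg_atBot_atTop.comp (Real.tendsto_log_nhdsGT_zero.comp ?_)
    refine tendsto_nhdsWithin_iff.2 ⟨by simpa using (hxi i).norm, Eventually.of_forall fun k => ?_⟩
    exact norm_pos_iff.2 (hx0 k i)
  obtain ⟨α₀, hα₀, D, hDA, b, ⟨b₀, hb⟩, hpos, hD, hDc⟩ :=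
    exists_weight_correction 𝓤 hA (w := fun k i => -Real.log ‖x k i‖) hw
  set w : ι → Fin n → ℝ := fun k => (fun i => -Real.log ‖x k i‖) - b k with hwdef
  let θ : ι → Fin n → ℂ := fun k i => x k i / ‖x k i‖
  have hθ : ∀ k i, ‖θ k i‖ = 1 := fun k i => by
    have := norm_pos_iff.2 (hx0 k i)
    simp [θ, this.ne']
  have hθlim : ∀ i, ∃ a ∈ Metric.sphere (0 : ℂ) 1, Tendsto (fun k => θ k i) 𝓤 (𝓝 a) := fun i =>
    exists_tendsto_of_eventually_mem 𝓤 (isCompact_sphere _ _)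
      (Eventually.of_forall fun k => by simpa using hθ k i)
  choose a ha hθa using hθlim
  let u : ι → Fin n → ℂ := fun k i => (Real.exp (-b k i) : ℝ) * θ k i
  let u₀ : Fin n → ℂ := fun i => (Real.exp (-b₀ i) : ℝ) * a i
  have hu : ∀ i, Tendsto (fun k => u k i) 𝓤 (𝓝 (u₀ i)) := fun i => by
    have h1 : Continuous fun t : ℝ => ((Real.exp (-t) : ℝ) : ℂ) := by fun_prop
    exact ((h1.tendsto _).comp (tendsto_pi_nhds.1 hb i)).mul (hθa i)
  have hxu : ∀ k i, x k i = (Real.exp (-w k i) : ℝ) * u k i := fun k i => by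
    have h0 := norm_pos_iff.2 (hx0 k i)
    have : Real.exp (-w k i) * Real.exp (-b k i) = ‖x k i‖ := by
      rw [← Real.exp_add]
      simp [hwdef, Real.exp_log h0]
    simp only [u, θ]
    rw [← mul_assoc, ← Complex.ofReal_mul, this, mul_div_cancel₀]
    exact_mod_cast h0.ne'
  have hmon : ∀ α ∈ A, Tendsto (fun k => (∏ i, x k i ^ α i) / (Real.exp (-(w k ⬝ᵥ expR α₀)) : ℝ)) 𝓤
      (𝓝 (if α ∈ D then ∏ i, u₀ i ^ α i else 0)) := by
    intro α hα
    have h1 : ∀ k, (∏ i, x k i ^ α i) / (Real.exp (-(w k ⬝ᵥ expR α₀)) : ℝ) =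
        (Real.exp (-(w k ⬝ᵥ expR α - w k ⬝ᵥ expR α₀)) : ℝ) * ∏ i, u k i ^ α i := fun k => by
      rw [prod_pow_eq_exp_mul (hxu k), mul_div_right_comm, ← Complex.ofReal_div, ← Real.exp_sub]
      ring_nf
    have h2 : Tendsto (fun k => ∏ i, u k i ^ α i) 𝓤 (𝓝 (∏ i, u₀ i ^ α i)) :=
      tendsto_finsetProd _ fun i _ => (hu i).pow _
    simp only [h1]
    split_ifs with h
    · have h3 : ∀ k, w k ⬝ᵥ expR α = w k ⬝ᵥ expR α₀ := fun k => hD k α h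
      simpa [h3] using h2
    · have h3 := (Real.tendsto_exp_neg_atTop_nhds_zero.comp (hDc α hα h)).ofReal.mul h2
      rw [Complex.ofReal_zero, zero_mul] at h3
      exact h3
  have hgood : ∀ᶠ k in (𝓤 : Filter ι), ∀ α ∈ A, α ∉ D → w k ⬝ᵥ expR α₀ < w k ⬝ᵥ expR α := by
    refine (eventually_all_finset A).2 fun α hα => ?_
    by_cases h : α ∈ D
    · simp [h]
    · exact ((hDc α hα h).eventually_gt_atTop 0).mono fun k hk _ => sub_pos.1 hk
  obtain ⟨k, hk1, hk2⟩ := (hpos.and hgood).exists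
  refine ⟨w k, hk1, α₀, hα₀, fun α hα => ?_, D, fun α => ⟨fun h => ⟨hDA h, hD k α h⟩, ?_⟩,
    u₀, fun i => ?_, fun k => Real.exp (-(w k ⬝ᵥ expR α₀)), fun k => Real.exp_pos _, ?_, ?_⟩
  · by_cases h : α ∈ D
    · exact (hD k α h).ge
    · exact (hk2 α hα h).le
  · rintro ⟨hα, h⟩
    by_contra h'
    exact (hk2 α hα h').ne' h
  · refine mul_ne_zero (by exact_mod_cast (Real.exp_pos _).ne') fun h => ?_
    have := ha i
    simp [h] at this
  · intro α hα
    have := (hmon α hα).norm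
    simp only [norm_div, Complex.norm_real, Real.norm_eq_abs, Real.abs_exp] at this
    convert this using 2
    split_ifs <;> simp
  · intro c c₀ hc
    have := tendsto_finsetSum A fun α hα => (hc α hα).mul (hmon α hα)
    rw [← Finset.sum_subset hDA (f := fun α => c₀ α * if α ∈ D then ∏ i, u₀ i ^ α i else 0)
      fun α _ h => by simp [h]] at this
    convert this using 2
    · rw [Finset.sum_div]
      exact Finset.sum_congr rfl fun α _ => mul_div_assoc _ _ _
    · exact Finset.sum_congr rfl fun α h => by simp [h]

end TorusEstimate

section Estimate

open Set Filter Topology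

variable {n : ℕ} {f : MvPolynomial (Fin n) ℂ} {S : Finset (Fin n →₀ ℕ)}

/-- The size of all monomials that can occur in a deformation of `f`. -/
def monomialSize (f : MvPolynomial (Fin n) ℂ) (S : Finset (Fin n →₀ ℕ)) (x : Fin n → ℂ) : ℝ :=
  ∑ α ∈ f.support ∪ S, ‖∏ i, x i ^ α i‖

theorem continuous_monomialSize : Continuous (monomialSize f S) := by
  unfold monomialSize
  fun_prop

theorem support_perturb_subset (y : {α // α ∈ S} → ℂ) :
    (perturb f S y).support ⊆ f.support ∪ S := by
  refine support_add.trans (Finset.union_subset_union_right fun α hα => ?_)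
  obtain ⟨β, -, hβ⟩ := Finset.mem_biUnion.1 (support_sum hα)
  rw [Finset.mem_singleton.1 (support_monomial_subset hβ)]
  exact β.2

theorem continuous_coeff_perturb (α : Fin n →₀ ℕ) :
    Continuous fun y => (perturb f S y).coeff α := by
  simp only [perturb, coeff_add, coeff_sum, coeff_monomial]
  refine continuous_const.add (continuous_finsetSum _ fun β _ => ?_)
  split_ifs
  · exact continuous_apply β
  · exact continuous_const

theorem perturb_eq_sum (y : {α // α ∈ S} → ℂ) :
    perturb f S y = ∑ α ∈ f.support ∪ S, monomial α ((perturb f S y).coeff α) := by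
  conv_lhs => rw [as_sum (perturb f S y)]
  exact Finset.sum_subset (support_perturb_subset y) fun α _ h => by
    rw [notMem_support_iff.1 h, monomial_zero]

theorem eval_perturb (x : Fin n → ℂ) (y : {α // α ∈ S} → ℂ) :
    eval x (perturb f S y) =
      ∑ α ∈ f.support ∪ S, (perturb f S y).coeff α * ∏ i, x i ^ α i := by
  conv_lhs => rw [perturb_eq_sum]
  simp only [map_sum, eval_monomial_eq_mul_prod]

theorem mul_eval_pderiv_perturb (x : Fin n → ℂ) (y : {α // α ∈ S} → ℂ) (i : Fin n) :
    x i * eval x (pderiv i (perturb f S y)) =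
      ∑ α ∈ f.support ∪ S, (α i * (perturb f S y).coeff α) * ∏ i, x i ^ α i := by
  conv_lhs => rw [perturb_eq_sum]
  simp only [map_sum, Finset.mul_sum, mul_eval_pderiv_monomial, mul_assoc]

/-- A combination with positive coefficients of complex numbers with a common phase can only tend
to zero if each of them does. -/
theorem eq_zero_of_tendsto_mul_of_sum_eq_zero {ι : Type*} {l : Filter ι} [l.NeBot]
    {ρ : ι → Fin n → ℝ} (hρ : ∀ k i, 0 ≤ ρ k i) {μ : ι → ℂ} {G : Fin n → ℂ}
    (hG : ∀ i, Tendsto (fun k => ρ k i * μ k) l (𝓝 (G i))) {w : Fin n → ℝ} (hw : ∀ i, 0 < w i)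
    (h0 : ∑ i, w i * G i = 0) (i : Fin n) : G i = 0 := by
  have h1 : Tendsto (fun k => ∑ i, w i * (ρ k i * μ k)) l (𝓝 0) :=
    h0 ▸ tendsto_finsetSum _ fun i _ => (hG i).const_mul _
  have h2 : Tendsto (fun k => (w i)⁻¹ * ‖∑ i, w i * (ρ k i * μ k)‖) l (𝓝 0) := by
    simpa using h1.norm.const_mul (w i)⁻¹
  refine tendsto_nhds_unique (hG i) (squeeze_zero_norm (fun k => ?_) h2)
  have h3 : ∑ i, (w i : ℂ) * (ρ k i * μ k) = (∑ i, w i * ρ k i : ℝ) * μ k := by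
    push_cast
    rw [Finset.sum_mul]
    exact Finset.sum_congr rfl fun i _ => by ring
  have h4 : w i * ρ k i ≤ ∑ i, w i * ρ k i :=
    Finset.single_le_sum (f := fun i => w i * ρ k i)
      (fun i _ => mul_nonneg (hw i).le (hρ k i)) (Finset.mem_univ i)
  have h5 : 0 ≤ ∑ i, w i * ρ k i := (mul_nonneg (hw i).le (hρ k i)).trans h4
  rw [h3, norm_mul, norm_mul, Complex.norm_real, Complex.norm_real, Real.norm_of_nonneg h5,
    Real.norm_of_nonneg (hρ k i), ← mul_assoc]
  refine mul_le_mul_of_nonneg_right ?_ (norm_nonneg _)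
  rwa [le_inv_mul_iff₀ (hw i)]

theorem tendsto_zero_of_norm_le_mul {ι : Type*} {l : Filter ι} {δ M N : ι → ℝ} {g : ι → ℂ} {m : ℝ}
    (hδ : Tendsto δ l (𝓝 0)) (hN : ∀ k, 0 < N k) (hM : Tendsto (fun k => M k / N k) l (𝓝 m))
    (hg : ∀ k, ‖g k‖ ≤ δ k * M k) : Tendsto (fun k => g k / N k) l (𝓝 0) := by
  refine squeeze_zero_norm (a := fun k => δ k * (M k / N k)) (fun k => ?_)
    (by simpa using hδ.mul hM)
  rw [norm_div, Complex.norm_real, Real.norm_of_nonneg (hN k).le, ← mul_div_assoc]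
  exact div_le_div_of_nonneg_right (hg k) (hN k).le

theorem false_of_ultrafilter_of_mem_Omega (hf : f.support.Nonempty)
    (hS : ∀ α ∈ S, expR α ∈ NewtonPolyhedron f) {y₀ : {α // α ∈ S} → ℂ} (hy₀ : y₀ ∈ Omega f S)
    {ι : Type*} (𝓤 : Ultrafilter ι) {x : ι → Fin n → ℂ} {y : ι → {α // α ∈ S} → ℂ} {μ : ι → ℂ}
    {δ : ι → ℝ} (hx : Tendsto x 𝓤 (𝓝 0)) (hy : Tendsto y 𝓤 (𝓝 y₀)) (hδ : Tendsto δ 𝓤 (𝓝 0))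
    (hx0 : ∀ k i, x k i ≠ 0)
    (h1 : ∀ k, ‖eval (x k) (perturb f S (y k))‖ ≤ δ k * monomialSize f S (x k))
    (h2 : ∀ k i, ‖x k i * eval (x k) (pderiv i (perturb f S (y k))) - (‖x k i‖ ^ 2 : ℝ) * μ k‖ ≤
      δ k * monomialSize f S (x k)) : False := by
  have hA : ∀ α ∈ f.support ∪ S, expR α ∈ NewtonPolyhedron f := fun α hα =>
    (Finset.mem_union.1 hα).elim expR_mem_newtonPolyhedron (hS α)
  obtain ⟨w, hw, α₀, hα₀, hmin, D, hD, u, hu, N, hN, hM, hc⟩ :=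
    exists_leading_part 𝓤 (A := f.support ∪ S) (hf.mono Finset.subset_union_left) hx hx0
  set c₀ : (Fin n →₀ ℕ) → ℂ := fun α => (perturb f S y₀).coeff α
  have hcoeff : ∀ α, Tendsto (fun k => (perturb f S (y k)).coeff α) 𝓤 (𝓝 (c₀ α)) := fun α =>
    ((continuous_coeff_perturb α).tendsto y₀).comp hy
  have hMlim : ∃ m, Tendsto (fun k => monomialSize f S (x k) / N k) 𝓤 (𝓝 m) :=
    ⟨_, (tendsto_finsetSum _ hM).congr fun k => (Finset.sum_div _ _ _).symm⟩
  obtain ⟨m, hm⟩ := hMlim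
  have hf0 : ∑ α ∈ D, c₀ α * ∏ i, u i ^ α i = 0 := by
    refine tendsto_nhds_unique (hc _ _ fun α _ => hcoeff α) ?_
    simp only [← eval_perturb]
    exact tendsto_zero_of_norm_le_mul hδ hN hm h1
  let G : Fin n → ℂ := fun i => ∑ α ∈ D, (α i * c₀ α) * ∏ j, u j ^ α j
  have hG : ∀ i, Tendsto (fun k => (‖x k i‖ ^ 2 : ℝ) * (μ k / N k)) 𝓤 (𝓝 (G i)) := by
    intro i
    have h3 := hc (fun k α => α i * (perturb f S (y k)).coeff α) (fun α => α i * c₀ α)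
      fun α _ => (hcoeff α).const_mul _
    simp only [← mul_eval_pderiv_perturb] at h3
    have h4 := h3.sub (tendsto_zero_of_norm_le_mul hδ hN hm fun k => h2 k i)
    rw [sub_zero] at h4
    exact h4.congr fun k => by ring
  have hsum : ∑ i, w i * G i = 0 := by
    have h3 : ∀ α ∈ D, ∑ i, (w i : ℂ) * ((α i * c₀ α) * ∏ j, u j ^ α j) =
        (w ⬝ᵥ expR α₀ : ℝ) * (c₀ α * ∏ j, u j ^ α j) := fun α hα => by
      rw [← ((hD α).1 hα).2, dotProduct, Complex.ofReal_sum, Finset.sum_mul]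
      refine Finset.sum_congr rfl fun i _ => ?_
      simp only [expR]
      push_cast
      ring
    simp only [G, Finset.mul_sum]
    rw [Finset.sum_comm, Finset.sum_congr rfl h3, ← Finset.mul_sum, hf0, mul_zero]
  have hG0 := eq_zero_of_tendsto_mul_of_sum_eq_zero (fun k i => sq_nonneg ‖x k i‖) hG hw hsum
  refine hy₀.2.not_torus_solution hy₀.1 (support_perturb_subset y₀) hA hw hα₀ hmin hD hu hf0
    fun i => ?_
  simpa only [G, mul_assoc] using hG0 i

/-- For parameters near `y₀ ∈ Ω` and points of the torus near `0`, the function and its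
logarithmic gradient (modulo the radial direction) cannot both be small compared to the size of
the monomials. -/
theorem exists_torus_estimate (hf : f.support.Nonempty)
    (hS : ∀ α ∈ S, expR α ∈ NewtonPolyhedron f) {y₀ : {α // α ∈ S} → ℂ} (hy₀ : y₀ ∈ Omega f S) :
    ∃ δ > 0, ∀ᶠ z : (Fin n → ℂ) × ({α // α ∈ S} → ℂ) in 𝓝 (0, y₀), (∀ i, z.1 i ≠ 0) → ∀ μ : ℂ,
      ‖eval z.1 (perturb f S z.2)‖ ≤ δ * monomialSize f S z.1 →
      ∃ i, δ * monomialSize f S z.1 <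
        ‖z.1 i * eval z.1 (pderiv i (perturb f S z.2)) - (‖z.1 i‖ ^ 2 : ℝ) * μ‖ := by
  by_contra! h
  have hδ : ∀ k : ℕ, (0 : ℝ) < 1 / (k + 1) := fun k => by positivity
  have key : ∀ k : ℕ, ∃ z : (Fin n → ℂ) × ({α // α ∈ S} → ℂ), ∃ μ : ℂ,
      dist z (0, y₀) < 1 / (k + 1) ∧ (∀ i, z.1 i ≠ 0) ∧
      ‖eval z.1 (perturb f S z.2)‖ ≤ 1 / (k + 1) * monomialSize f S z.1 ∧
      ∀ i, ‖z.1 i * eval z.1 (pderiv i (perturb f S z.2)) - (‖z.1 i‖ ^ 2 : ℝ) * μ‖ ≤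
        1 / (k + 1) * monomialSize f S z.1 := by
    intro k
    obtain ⟨z, ⟨hz0, μ, h1, h2⟩, hz⟩ :=
      ((h _ (hδ k)).and_eventually (Metric.ball_mem_nhds _ (hδ k))).exists
    exact ⟨z, μ, hz, hz0, h1, h2⟩
  choose z μ hz hz0 h1 h2 using key
  have hlim : Tendsto z (hyperfilter ℕ) (𝓝 (0, y₀)) :=
    (tendsto_iff_dist_tendsto_zero.2 (squeeze_zero (fun _ => dist_nonneg) (fun k => (hz k).le)
      tendsto_one_div_add_atTop_nhds_zero_nat)).mono_left Nat.hyperfilter_le_atTop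
  exact false_of_ultrafilter_of_mem_Omega hf hS hy₀ (hyperfilter ℕ) (hlim.fst_nhds)
    (hlim.snd_nhds)
    (tendsto_one_div_add_atTop_nhds_zero_nat.mono_left Nat.hyperfilter_le_atTop) hz0 h1 h2

end Estimate

section Transversality

open Set Filter Topology ComplexConjugate

variable {n : ℕ} {f : MvPolynomial (Fin n) ℂ} {S : Finset (Fin n →₀ ℕ)}

/-- The Cauchy–Schwarz defect `|g|² |x|² - |∑ gᵢ xᵢ|²`. -/
def cauchySchwarzDefect (x g : Fin n → ℂ) : ℝ :=
  (∑ i, ‖g i‖ ^ 2) * ∑ i, ‖x i‖ ^ 2 - ‖∑ i, g i * x i‖ ^ 2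

/-- The component of `x` in the kernel of `v ↦ ∑ gᵢ vᵢ`, scaled by `|g|²`. -/
def kernelComponent (x g : Fin n → ℂ) (i : Fin n) : ℂ :=
  (∑ j, ‖g j‖ ^ 2 : ℝ) * x i - (∑ j, g j * x j) * conj (g i)

theorem sum_mul_kernelComponent (x g : Fin n → ℂ) : ∑ i, g i * kernelComponent x g i = 0 := by
  simp only [kernelComponent, mul_sub, Finset.sum_sub_distrib]
  rw [sub_eq_zero]
  calc ∑ i, g i * ((∑ j, ‖g j‖ ^ 2 : ℝ) * x i) = (∑ j, ‖g j‖ ^ 2 : ℝ) * ∑ i, g i * x i := by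
        rw [Finset.mul_sum]; exact Finset.sum_congr rfl fun i _ => by ring
    _ = (∑ j, g j * x j) * ∑ i, g i * conj (g i) := by
        rw [mul_comm]
        congr 1
        push_cast
        exact Finset.sum_congr rfl fun i _ => (Complex.mul_conj' _).symm
    _ = _ := by
        rw [Finset.mul_sum]; exact Finset.sum_congr rfl fun i _ => by ring

theorem sum_conj_mul_kernelComponent (x g : Fin n → ℂ) :
    ∑ i, conj (x i) * kernelComponent x g i = cauchySchwarzDefect x g := by
  simp only [kernelComponent, mul_sub, Finset.sum_sub_distrib, cauchySchwarzDefect]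
  push_cast
  congr 1
  · rw [Finset.mul_sum]
    exact Finset.sum_congr rfl fun i _ => by rw [← Complex.mul_conj']; ring
  · rw [← Complex.mul_conj', map_sum, Finset.mul_sum]
    exact Finset.sum_congr rfl fun i _ => by rw [map_mul]; ring

theorem kernelComponent_eq_zero {x g : Fin n → ℂ} (h : cauchySchwarzDefect x g = 0) (i : Fin n) :
    kernelComponent x g i = 0 := by
  have h1 : ∑ i, kernelComponent x g i * conj (kernelComponent x g i) = 0 := by
    calc ∑ i, kernelComponent x g i * conj (kernelComponent x g i)
        = (∑ j, ‖g j‖ ^ 2 : ℝ) * ∑ i, conj (x i) * kernelComponent x g i -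
          conj (∑ j, g j * x j) * ∑ i, g i * kernelComponent x g i := by
          rw [Finset.mul_sum, Finset.mul_sum, ← Finset.sum_sub_distrib]
          refine Finset.sum_congr rfl fun i _ => ?_
          have : conj (kernelComponent x g i) =
              (∑ j, ‖g j‖ ^ 2 : ℝ) * conj (x i) - conj (∑ j, g j * x j) * g i := by
            simp only [kernelComponent, map_sub, map_mul, Complex.conj_ofReal, Complex.conj_conj]
          rw [this]
          ring
      _ = 0 := by rw [sum_conj_mul_kernelComponent, sum_mul_kernelComponent, h]; simp
  have h2 : ∑ i, ‖kernelComponent x g i‖ ^ 2 = 0 := by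
    simp only [Complex.mul_conj'] at h1
    exact_mod_cast h1
  have := (Finset.sum_eq_zero_iff_of_nonneg fun i _ => sq_nonneg _).1 h2 i (Finset.mem_univ i)
  simpa using this

theorem exists_mul_eq_of_cauchySchwarzDefect_eq_zero {x g : Fin n → ℂ}
    (h : cauchySchwarzDefect x g = 0) : ∃ μ : ℂ, ∀ i, x i * g i = (‖x i‖ ^ 2 : ℝ) * μ := by
  by_cases hg : g = 0
  · exact ⟨0, fun i => by simp [hg]⟩
  have hg2 : (∑ j, ‖g j‖ ^ 2 : ℝ) ≠ 0 := fun h0 => hg <| funext fun j => by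
    simpa using (Finset.sum_eq_zero_iff_of_nonneg fun i _ => sq_nonneg _).1 h0 j (Finset.mem_univ j)
  have hx : ∀ i, ((∑ j, ‖g j‖ ^ 2 : ℝ) : ℂ) * x i = (∑ j, g j * x j) * conj (g i) := fun i =>
    sub_eq_zero.1 (kernelComponent_eq_zero h i)
  generalize (∑ j, ‖g j‖ ^ 2 : ℝ) = a at *
  generalize (∑ j, g j * x j) = s at *
  have ha : (a : ℂ) ≠ 0 := by exact_mod_cast hg2
  refine ⟨a / conj s, fun i => ?_⟩
  by_cases hs : s = 0
  · have : x i = 0 := by simpa [hs, hg2] using hx i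
    simp [this]
  have hs' : conj s ≠ 0 := by simpa using hs
  have h1 : a * conj (x i) = conj s * g i := by simpa using congrArg conj (hx i)
  rw [Complex.ofReal_pow, ← Complex.mul_conj', mul_div_assoc', eq_div_iff hs']
  linear_combination -(x i) * h1

/-- The gradient of `σ_y f` at `x`. -/
def gradPerturb (f : MvPolynomial (Fin n) ℂ) (S : Finset (Fin n →₀ ℕ))
    (z : (Fin n → ℂ) × ({α // α ∈ S} → ℂ)) (i : Fin n) : ℂ :=
  eval z.1 (pderiv i (perturb f S z.2))

theorem monomialSize_pos (hconv : Convenient f) {x : Fin n → ℂ} (hx : x ≠ 0) :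
    0 < monomialSize f S x := by
  obtain ⟨i, hi⟩ := Function.ne_iff.1 hx
  obtain ⟨α, hα, hα0⟩ := hconv.exists_mem_support i
  refine Finset.sum_pos' (fun _ _ => norm_nonneg _) ⟨α, Finset.mem_union_left _ hα, ?_⟩
  refine norm_pos_iff.2 (Finset.prod_ne_zero_iff.2 fun j _ => ?_)
  by_cases hj : j = i
  · exact hj ▸ pow_ne_zero _ hi
  · simp [hα0 j hj]

theorem dense_torus : Dense {x : Fin n → ℂ | ∀ i, x i ≠ 0} := by
  have : Dense ((univ : Set (Fin n)).pi fun _ => ({0}ᶜ : Set ℂ)) :=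
    dense_pi univ fun _ _ => dense_compl_singleton 0
  refine this.mono ?_
  exact fun x hx i => hx i trivial

/-- Small spheres are transverse to the hypersurfaces `σ_y f = 0`, locally uniformly in `y ∈ Ω`. -/
theorem eventually_cauchySchwarzDefect_ne_zero (hconv : Convenient f)
    (hS : ∀ α ∈ S, expR α ∈ NewtonPolyhedron f) {y₀ : {α // α ∈ S} → ℂ} (hy₀ : y₀ ∈ Omega f S) :
    ∀ᶠ z : (Fin n → ℂ) × ({α // α ∈ S} → ℂ) in 𝓝 (0, y₀), eval z.1 (perturb f S z.2) = 0 →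
      z.1 ≠ 0 → cauchySchwarzDefect z.1 (gradPerturb f S z) ≠ 0 := by
  rcases n.eq_zero_or_pos with rfl | hn
  · exact Eventually.of_forall fun z _ h => absurd (Subsingleton.elim _ _) h
  have hf : f.support.Nonempty := (hconv.exists_mem_support ⟨0, hn⟩).imp fun _ h => h.1
  obtain ⟨δ, hδ, h⟩ := exists_torus_estimate hf hS hy₀
  filter_upwards [eventually_eventually_nhds.2 h] with ⟨x, y⟩ hz h0 hx hq
  obtain ⟨μ, hμ⟩ := exists_mul_eq_of_cauchySchwarzDefect_eq_zero hq
  have hpos : 0 < δ * monomialSize f S x := mul_pos hδ (monomialSize_pos hconv hx)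
  have hM : Continuous fun x' : Fin n → ℂ => δ * monomialSize f S x' :=
    continuous_const.mul continuous_monomialSize
  have h1 : ∀ᶠ x' in 𝓝 x, ‖eval x' (perturb f S y)‖ < δ * monomialSize f S x' := by
    refine ContinuousAt.eventually_lt ?_ hM.continuousAt (by simpa [show eval x _ = 0 from h0])
    exact (continuous_eval _).norm.continuousAt
  have h2 : ∀ᶠ x' in 𝓝 x, ∀ i,
      ‖x' i * eval x' (pderiv i (perturb f S y)) - (‖x' i‖ ^ 2 : ℝ) * μ‖ <
        δ * monomialSize f S x' := by
    refine eventually_all.2 fun i => ContinuousAt.eventually_lt ?_ hM.continuousAt ?_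
    · have := continuous_eval (pderiv i (perturb f S y))
      exact Continuous.continuousAt (by fun_prop)
    · have : x i * eval x (pderiv i (perturb f S y)) = (‖x i‖ ^ 2 : ℝ) * μ := hμ i
      rwa [this, sub_self, norm_zero]
  have h3 : Tendsto (fun x' => (x', y)) (𝓝 x) (𝓝 (x, y)) :=
    (Continuous.prodMk_left y).tendsto x
  obtain ⟨x', hx', h1, h2, h3⟩ := ((mem_closure_iff_frequently.1 (dense_torus x)).and_eventually
    (h1.and (h2.and (h3.eventually hz)))).exists
  obtain ⟨i, hi⟩ := h3 hx' μ h1.le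
  exact (h2 i).not_gt hi

end Transversality

section Application

open Set Filter Topology ComplexConjugate

variable {n : ℕ} {f : MvPolynomial (Fin n) ℂ} {S : Finset (Fin n →₀ ℕ)}

theorem hasDerivAt_eval_add_smul (p : MvPolynomial (Fin n) ℂ) (x v : Fin n → ℂ) :
    HasDerivAt (fun t : ℝ => eval (x + t • v) p) (∑ i, eval x (pderiv i p) * v i) 0 := by
  induction p using MvPolynomial.induction_on with
  | C a => simpa using hasDerivAt_const (0 : ℝ) a
  | add p q hp hq =>
    simpa [add_mul, Finset.sum_add_distrib] using hp.fun_add hq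
  | mul_X p i hp =>
    have h1 : HasDerivAt (fun t : ℝ => x i + t • v i) (v i) 0 := by
      simpa using ((hasDerivAt_id (0 : ℝ)).smul_const (v i)).const_add (x i)
    have h2 := hp.mul h1
    simp only [map_mul, eval_X, Pi.add_apply, Pi.smul_apply, Derivation.leibniz, smul_eq_mul,
      map_add, pderiv_X]
    refine h2.congr_deriv ?_
    simp [add_mul, Finset.sum_add_distrib, Finset.sum_mul, Pi.single_apply, apply_ite]
    rw [add_comm]
    congr 1
    exact Finset.sum_congr rfl fun j _ => by ring

theorem contDiff_eval (p : MvPolynomial (Fin n) ℂ) :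
    ContDiff ℝ 1 fun x : Fin n → ℂ => eval x p := by
  simp only [eval_eq']
  fun_prop

theorem contDiff_eval_perturb :
    ContDiff ℝ 1 fun z : (Fin n → ℂ) × ({α // α ∈ S} → ℂ) => eval z.1 (perturb f S z.2) := by
  simp only [perturb, map_add, map_sum, eval_monomial_eq_mul_prod]
  have := (contDiff_eval f).comp (contDiff_fst (E := Fin n → ℂ) (F := {α // α ∈ S} → ℂ))
  refine this.add ?_
  fun_prop

theorem contDiff_gradPerturb (i : Fin n) :
    ContDiff ℝ 1 fun z : (Fin n → ℂ) × ({α // α ∈ S} → ℂ) => gradPerturb f S z i := by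
  simp only [gradPerturb, perturb, map_add, map_sum, pderiv_monomial, eval_monomial_eq_mul_prod]
  have := (contDiff_eval (pderiv i f)).comp
    (contDiff_fst (E := Fin n → ℂ) (F := {α // α ∈ S} → ℂ))
  refine this.add ?_
  fun_prop

theorem contDiff_cauchySchwarzDefect :
    ContDiff ℝ 1 fun z : (Fin n → ℂ) × ({α // α ∈ S} → ℂ) =>
      cauchySchwarzDefect z.1 (gradPerturb f S z) := by
  have h1 := contDiff_gradPerturb (f := f) (S := S)
  have h2 : ∀ i : Fin n, ContDiff ℝ 1 fun z : (Fin n → ℂ) × ({α // α ∈ S} → ℂ) => z.1 i :=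
    fun i => by fun_prop
  unfold cauchySchwarzDefect
  refine ((ContDiff.sum fun i _ => (h1 i).norm_sq ℝ).mul
    (ContDiff.sum fun i _ => (h2 i).norm_sq ℝ)).sub (ContDiff.norm_sq ℝ ?_)
  exact ContDiff.sum fun i _ => (h1 i).mul (h2 i)

theorem contDiff_kernelComponent (i : Fin n) :
    ContDiff ℝ 1 fun z : (Fin n → ℂ) × ({α // α ∈ S} → ℂ) =>
      kernelComponent z.1 (gradPerturb f S z) i := by
  have h1 := contDiff_gradPerturb (f := f) (S := S)
  have h2 : ∀ i : Fin n, ContDiff ℝ 1 fun z : (Fin n → ℂ) × ({α // α ∈ S} → ℂ) => z.1 i :=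
    fun i => by fun_prop
  unfold kernelComponent
  refine ContDiff.sub (ContDiff.mul ?_ (h2 i)) (ContDiff.mul ?_ ?_)
  · have h3 : ContDiff ℝ 1 fun z : (Fin n → ℂ) × ({α // α ∈ S} → ℂ) =>
        ∑ j, ‖gradPerturb f S z j‖ ^ 2 := ContDiff.sum fun i _ => (h1 i).norm_sq ℝ
    exact Complex.ofRealCLM.contDiff.comp h3
  · exact ContDiff.sum fun i _ => (h1 i).mul (h2 i)
  · exact Complex.conjCLE.contDiff.comp (h1 i)

theorem hasFDerivAt_sum_norm_sq (z : (Fin n → ℂ) × ({α // α ∈ S} → ℂ)) :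
    HasFDerivAt (fun z : (Fin n → ℂ) × ({α // α ∈ S} → ℂ) => ∑ i, ‖z.1 i‖ ^ 2)
      (∑ i, (2 : ℕ) • (innerSL ℝ (z.1 i)).comp ((ContinuousLinearMap.proj i).comp
        (ContinuousLinearMap.fst ℝ (Fin n → ℂ) ({α // α ∈ S} → ℂ)))) z := by
  refine HasFDerivAt.fun_sum fun i _ => HasFDerivAt.norm_sq ?_
  exact ((ContinuousLinearMap.proj i).comp
    (ContinuousLinearMap.fst ℝ (Fin n → ℂ) ({α // α ∈ S} → ℂ))).hasFDerivAt

/-- A vector field tangent to the fibres of `(x, y) ↦ (σ_y f(x), y)` that scales `|x|²`. -/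
def radialField (f : MvPolynomial (Fin n) ℂ) (S : Finset (Fin n →₀ ℕ))
    (z : (Fin n → ℂ) × ({α // α ∈ S} → ℂ)) : (Fin n → ℂ) × ({α // α ∈ S} → ℂ) :=
  (((∑ i, ‖z.1 i‖ ^ 2) / (2 * cauchySchwarzDefect z.1 (gradPerturb f S z))) •
    kernelComponent z.1 (gradPerturb f S z), 0)

theorem contDiffOn_radialField : ContDiffOn ℝ 1 (radialField f S)
    {z | cauchySchwarzDefect z.1 (gradPerturb f S z) ≠ 0} := by
  have h2 : ∀ i : Fin n, ContDiff ℝ 1 fun z : (Fin n → ℂ) × ({α // α ∈ S} → ℂ) => z.1 i :=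
    fun i => by fun_prop
  refine ContDiffOn.prodMk (ContDiffOn.fun_smul (ContDiffOn.fun_div ?_ ?_ ?_) ?_) contDiffOn_const
  · exact (ContDiff.sum fun i _ => (h2 i).norm_sq ℝ).contDiffOn
  · exact (contDiff_const.mul contDiff_cauchySchwarzDefect).contDiffOn
  · exact fun z hz => mul_ne_zero two_ne_zero hz
  · exact (contDiff_pi.2 contDiff_kernelComponent).contDiffOn

theorem fderiv_sum_norm_sq_radialField {z : (Fin n → ℂ) × ({α // α ∈ S} → ℂ)}
    (hz : cauchySchwarzDefect z.1 (gradPerturb f S z) ≠ 0) :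
    fderiv ℝ (fun z : (Fin n → ℂ) × ({α // α ∈ S} → ℂ) => ∑ i, ‖z.1 i‖ ^ 2) z
      (radialField f S z) = ∑ i, ‖z.1 i‖ ^ 2 := by
  have h := congrArg Complex.re (sum_conj_mul_kernelComponent z.1 (gradPerturb f S z))
  rw [Complex.re_sum, Complex.ofReal_re] at h
  rw [(hasFDerivAt_sum_norm_sq z).fderiv]
  simp only [sum_apply, smul_apply, ContinuousLinearMap.comp_apply,
    ContinuousLinearMap.coe_fst', ContinuousLinearMap.proj_apply, innerSL_apply_apply]
  simp only [radialField, Pi.smul_apply, real_inner_smul_right, Complex.inner]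
  simp only [nsmul_eq_mul, ← Finset.mul_sum, mul_comm _ (conj _), h]
  field_simp
  push_cast
  ring

theorem fderiv_eval_perturb_radialField (z : (Fin n → ℂ) × ({α // α ∈ S} → ℂ)) :
    fderiv ℝ (fun z : (Fin n → ℂ) × ({α // α ∈ S} → ℂ) => (eval z.1 (perturb f S z.2), z.2)) z
      (radialField f S z) = 0 := by
  have hd : Differentiable ℝ fun z : (Fin n → ℂ) × ({α // α ∈ S} → ℂ) =>
      (eval z.1 (perturb f S z.2), z.2) :=
    (contDiff_eval_perturb.differentiable one_ne_zero).prodMk differentiable_snd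
  rw [← (hd z).lineDeriv_eq_fderiv]
  refine HasLineDerivAt.lineDeriv ?_
  have h := hasDerivAt_eval_add_smul (perturb f S z.2) z.1 (radialField f S z).1
  have h0 : ∑ i, eval z.1 (pderiv i (perturb f S z.2)) * (radialField f S z).1 i = 0 := by
    have := sum_mul_kernelComponent z.1 (gradPerturb f S z)
    simp only [radialField, Pi.smul_apply, mul_smul_comm, ← Finset.smul_sum]
    rw [show ∑ i, eval z.1 (pderiv i (perturb f S z.2)) *
      kernelComponent z.1 (gradPerturb f S z) i = 0 from this, smul_zero]
  rw [h0] at h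
  refine ((h.prodMk (hasDerivAt_const (0 : ℝ) z.2)).congr_deriv
    Prod.mk_zero_zero).congr_of_eventuallyEq (Eventually.of_forall fun t => ?_)
  simp [radialField]

/-- A punctured ball is homotopy equivalent to its sphere along the deformed hypersurface as soon
as the Cauchy–Schwarz defect vanishes nowhere on it. -/
theorem nonempty_homotopyEquiv_Vtilde {U : Set ({α // α ∈ S} → ℂ)} (hU : IsCompact (closure U))
    {ε : ℝ} (hε : 0 < ε)
    (h : ∀ x : Fin n → ℂ, ∑ i, ‖x i‖ ^ 2 ≤ ε ^ 2 → ∀ y ∈ closure U, eval x (perturb f S y) = 0 →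
      x ≠ 0 → cauchySchwarzDefect x (gradPerturb f S (x, y)) ≠ 0) :
    Nonempty (ContinuousMap.HomotopyEquiv
      ↥(Vtilde f S ∩ ((eBall n ε \ {0}) ×ˢ U)) ↥(Vtilde f S ∩ (eSphere n ε ×ˢ U))) := by
  let N : (Fin n → ℂ) × ({α // α ∈ S} → ℂ) → ℝ := fun z => ∑ i, ‖z.1 i‖ ^ 2
  let G : (Fin n → ℂ) × ({α // α ∈ S} → ℂ) → ℂ × ({α // α ∈ S} → ℂ) :=
    fun z => (eval z.1 (perturb f S z.2), z.2)
  have hN : Differentiable ℝ N := fun z => (hasFDerivAt_sum_norm_sq z).differentiableAt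
  have hG : Differentiable ℝ G :=
    (contDiff_eval_perturb.differentiable one_ne_zero).prodMk differentiable_snd
  have hpos : ∀ z, 0 < N z ↔ z.1 ≠ 0 := fun z => by
    rw [(Finset.sum_nonneg fun i _ => sq_nonneg ‖z.1 i‖).lt_iff_ne', not_iff_not,
      Finset.sum_eq_zero_iff_of_nonneg fun i _ => sq_nonneg _]
    simp [funext_iff]
  have key := nonempty_homotopyEquiv_of_levelFlow (v := radialField f S)
    (W := {z | cauchySchwarzDefect z.1 (gradPerturb f S z) ≠ 0}) (N := N) (G := G)
    (B := {0} ×ˢ closure U) (O := {0} ×ˢ U) (R := ε ^ 2)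
    (isOpen_ne_fun contDiff_cauchySchwarzDefect.continuous continuous_const)
    contDiffOn_radialField hN hG (fun z => Finset.sum_nonneg fun i _ => sq_nonneg _)
    (fun z hz => fderiv_sum_norm_sq_radialField hz)
    (fun z _ => fderiv_eval_perturb_radialField z) (by positivity) (fun a _ => ?_)
    (fun z hz h0 hR => h z.1 hR z.2 hz.2 hz.1 ((hpos z).1 h0))
    (prod_mono_right subset_closure)
  · have h1 : Vtilde f S ∩ ((eBall n ε \ {0}) ×ˢ U) =
        {z | G z ∈ ({0} : Set ℂ) ×ˢ U ∧ 0 < N z ∧ N z < ε ^ 2} := by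
      ext z
      simp only [hpos, Vtilde, eBall, G, N, mem_inter_iff, mem_prod, Set.mem_sdiff, mem_ofPred_eq,
        mem_singleton_iff]
      tauto
    have h2 : Vtilde f S ∩ (eSphere n ε ×ˢ U) = {z | G z ∈ ({0} : Set ℂ) ×ˢ U ∧ N z = ε ^ 2} := by
      ext z
      simp only [Vtilde, eSphere, G, N, mem_inter_iff, mem_prod, mem_ofPred_eq, mem_singleton_iff]
      tauto
    rw [h1, h2]
    exact key
  · refine ((isCompact_closedBall (0 : Fin n → ℂ) ε).prod hU).of_isClosed_subset ?_ ?_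
    · exact ((isClosed_singleton.prod isClosed_closure).preimage hG.continuous).inter
        ((isClosed_le continuous_const hN.continuous).inter
          (isClosed_le hN.continuous continuous_const))
    · rintro z ⟨hz, -, hR⟩
      refine ⟨mem_closedBall_zero_iff.2 ((pi_norm_le_iff_of_nonneg hε.le).2 fun i => ?_), hz.2⟩
      refine le_of_sq_le_sq ?_ hε.le
      exact (Finset.single_le_sum (f := fun i => ‖z.1 i‖ ^ 2) (fun i _ => sq_nonneg _)
        (Finset.mem_univ i)).trans hR

theorem exists_radius_cauchySchwarzDefect_ne_zero (hconv : Convenient f)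
    (hS : ∀ α ∈ S, expR α ∈ NewtonPolyhedron f) {K : Set ({α // α ∈ S} → ℂ)} (hK : IsCompact K)
    (hKΩ : K ⊆ Omega f S) :
    ∃ ε₀ > 0, ∀ x : Fin n → ℂ, ∑ i, ‖x i‖ ^ 2 ≤ ε₀ ^ 2 → ∀ y ∈ K, eval x (perturb f S y) = 0 →
      x ≠ 0 → cauchySchwarzDefect x (gradPerturb f S (x, y)) ≠ 0 := by
  have := hK.eventually_forall_of_forall_eventually (x₀ := (0 : Fin n → ℂ))
    (P := fun x y => eval x (perturb f S y) = 0 → x ≠ 0 →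
      cauchySchwarzDefect x (gradPerturb f S (x, y)) ≠ 0)
    fun y hy => eventually_cauchySchwarzDefect_ne_zero hconv hS (hKΩ hy)
  obtain ⟨ε₀, hε₀, h⟩ := Metric.nhds_basis_closedBall.eventually_iff.1 this
  refine ⟨ε₀, hε₀, fun x hx => h (mem_closedBall_zero_iff.2 ?_)⟩
  refine (pi_norm_le_iff_of_nonneg hε₀.le).2 fun i => le_of_sq_le_sq ?_ hε₀.le
  exact (Finset.single_le_sum (f := fun i => ‖x i‖ ^ 2) (fun i _ => sq_nonneg _)
    (Finset.mem_univ i)).trans hx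

end Application

/-- Lemma 5.3 (cone lemma), first part: for relatively compact open `U ⊆ Ω`, and all
sufficiently small `ε > 0`, `Ṽ ∩ ((B(0,ε) ∖ {0}) × U)` is homotopy equivalent to
`Ṽ ∩ (S(0,ε) × U)`. -/
theorem stmt2 (n : ℕ) (hn : 2 ≤ n) (f : MvPolynomial (Fin n) ℂ)
    (hfnc : ¬ ∃ c : ℂ, f = C c) (hf0 : eval (0 : Fin n → ℂ) f = 0)
    (hconv : Convenient f) (hnd : NondegAtZero f)
    (hsing : IsSingularPt f 0)
    (hiso : ∃ U : Set (Fin n → ℂ), IsOpen U ∧ (0 : Fin n → ℂ) ∈ U ∧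
      ∀ x ∈ U, x ≠ 0 → ¬ IsSingularPt f x)
    (P : Set (Fin n → ℝ)) (hPpoly : ∃ T : Finset (Fin n → ℝ), P = convexHull ℝ ↑T)
    (hPsub : P ⊆ NewtonPolyhedron f)
    (S : Finset (Fin n →₀ ℕ)) (hS : ∀ α : Fin n →₀ ℕ, α ∈ S ↔ expR α ∈ P)
    (hPface : boundedFacesUnion (newtonRegion {α | α ∈ S}) = NewtonBoundary f)
    (U : Set ({α // α ∈ S} → ℂ)) (hUopen : IsOpen U) (hUsub : U ⊆ Omega f S)
    (hUcpt : IsCompact (closure U)) (hUcl : closure U ⊆ Omega f S) :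
    ∃ ε₀ : ℝ, 0 < ε₀ ∧ ∀ ε : ℝ, 0 < ε → ε ≤ ε₀ →
      Nonempty (ContinuousMap.HomotopyEquiv
        ↥(Vtilde f S ∩ ((eBall n ε \ {0}) ×ˢ U))
        ↥(Vtilde f S ∩ (eSphere n ε ×ˢ U))) := by
  obtain ⟨ε₀, hε₀, h⟩ := exists_radius_cauchySchwarzDefect_ne_zero hconv
    (fun α hα => hPsub ((hS α).1 hα)) hUcpt hUcl
  exact ⟨ε₀, hε₀, fun ε hε hle => nonempty_homotopyEquiv_Vtilde hUcpt hε fun x hx =>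
    h x (hx.trans (by gcongr))⟩
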